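/- (Larman's False Center theorem) Let n ≥ 2 and let B ⊂ ℝ^{n+1} be a convex body containing the origin in its interior. If every hyperplane section of B through the origin is centrally symmetric (for every n-dimensional linear subspace H of ℝ^{n+1} there is a point c ∈ H with B ∩ H = 2c - (B ∩ H)), then either B is an ellipsoid or B is symmetric with respect to the origin (B = -B). -/

import Mathlib

open Metric

/-- A subset of a real vector space is an ellipsoid if it is the image of the closed
Euclidean unit ball under a bijective affine map. -/
def IsEllipsoid {E : Type*} [NormedAddCommGroup E] [InnerProductSpace ℝ E]
    (K : Set E) : Prop :=
  ∃ g : E ≃ᵃ[ℝ] E, K = g '' closedBall (0 : E) 1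

section FalseCenterExists

variable {E : Type*} [NormedAddCommGroup E] [InnerProductSpace ℝ E]

lemma exists_linear_vanishing_pair [FiniteDimensional ℝ E] (h3 : 3 ≤ Module.finrank ℝ E)
    (x y : E) : ∃ f : E →ₗ[ℝ] ℝ, f ≠ 0 ∧ f x = 0 ∧ f y = 0 := by
  have hlt : Submodule.span ℝ {x, y} < ⊤ := by
    rw [lt_top_iff_ne_top]
    intro h
    classical
    have h1 := finrank_span_le_card (R := ℝ) (M := E) ({x, y} : Set E)
    rw [h, finrank_top] at h1
    have h2 : ({x, y} : Set E).toFinset.card ≤ 2 := by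
      rw [Set.toFinset_insert, Set.toFinset_singleton]
      exact Finset.card_le_two
    omega
  obtain ⟨f, hf, hle⟩ := Submodule.exists_le_ker_of_lt_top _ hlt
  exact ⟨f, hf, hle (Submodule.subset_span (by simp)), hle (Submodule.subset_span (by simp))⟩

lemma exists_notMem_span_pair [FiniteDimensional ℝ E] (h3 : 3 ≤ Module.finrank ℝ E)
    (x y : E) : ∃ w : E, w ∉ Submodule.span ℝ {x, y} := by
  obtain ⟨f, hf, hx, hy⟩ := exists_linear_vanishing_pair h3 x y
  obtain ⟨w, hw⟩ : ∃ w, f w ≠ 0 := by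
    by_contra! h
    exact hf (LinearMap.ext h)
  refine ⟨w, fun h => hw ?_⟩
  have : Submodule.span ℝ {x, y} ≤ LinearMap.ker f := by
    rw [Submodule.span_le]
    rintro z (rfl | rfl) <;> assumption
  exact this h

/-- The center of a central section through an extremal chord, rescaled, is again an endpoint of
an extremal chord. -/
lemma exists_contact_point_of_section {B : Set E} (hBc : IsClosed B) {μ : ℝ} (hμ1 : 1 < μ)
    (hμ : ∀ y ∈ B, -(μ⁻¹ • y) ∈ B) {u : E →ₗ[ℝ] ℝ} (hu : ∀ y ∈ B, u y ≤ 1) {x : E}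
    (hx : x ∈ B) (hx' : -(μ • x) ∈ B) (hux : u x = 1)
    {f : E →ₗ[ℝ] ℝ} (hfx : f x = 0)
    (hc : ∃ c, f c = 0 ∧ ∀ y ∈ B, f y = 0 → (2 : ℝ) • c - y ∈ B) :
    ∃ z, f z = 0 ∧ u z = 1 ∧ z ∈ B ∧ -(μ • z) ∈ B ∧
      ∀ y ∈ B, f y = 0 → (1 - μ) • z - y ∈ B := by
  obtain ⟨c, hfc, hc⟩ := hc
  have hμ0 : 0 < μ := by linarith
  have hlow : ∀ y ∈ B, -μ ≤ u y := by
    intro y hy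
    have := hu _ (hμ y hy)
    simp only [map_neg, map_smul, smul_eq_mul] at this
    have h2 : μ * (μ⁻¹ * u y) = u y := by field_simp
    nlinarith
  have huc : u c = (1 - μ) / 2 := by
    have h1 := hlow _ (hc x hx hfx)
    have h2 := hu _ (hc _ hx' (by simp [hfx]))
    simp only [map_sub, map_smul, smul_eq_mul, map_neg, hux] at h1 h2
    linarith
  obtain ⟨z, hz⟩ : ∃ z : E, z = (2 / (1 - μ)) • c := ⟨_, rfl⟩
  have hne : (1 - μ) ≠ 0 := by linarith
  have hzc : (1 - μ) • z = (2 : ℝ) • c := by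
    rw [hz, smul_smul]; congr 1; field_simp
  have hfz : f z = 0 := by simp [hz, hfc]
  have hzB : z ∈ B := by
    have hit : ∀ n : ℕ, z + (μ⁻¹) ^ n • (x - z) ∈ B := by
      intro n
      induction n with
      | zero => simpa using hx
      | succ k ih =>
        have h1 := hμ _ (hc _ ih (by simp [hfz, hfx]))
        convert h1 using 1
        rw [← hzc, pow_succ]
        have : μ⁻¹ * μ = 1 := by field_simp
        match_scalars <;> linarith
    have hl : Filter.Tendsto (fun n : ℕ => z + (μ⁻¹) ^ n • (x - z)) Filter.atTop (nhds z) := by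
      have h1 : Filter.Tendsto (fun n : ℕ => (μ⁻¹) ^ n) Filter.atTop (nhds 0) :=
        tendsto_pow_atTop_nhds_zero_of_lt_one (by positivity) (inv_lt_one_of_one_lt₀ hμ1)
      simpa using (h1.smul_const (x - z)).const_add z
    exact hBc.mem_of_tendsto hl (Filter.Eventually.of_forall hit)
  refine ⟨z, hfz, ?_, hzB, ?_, ?_⟩
  · simp only [hz, map_smul, huc, smul_eq_mul]; field_simp
  · have := hc z hzB hfz
    rw [← hzc] at this
    convert this using 1
    module
  · intro y hy hfy
    rw [hzc]; exact hc y hy hfy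

lemma exists_center_of_extremal_chord [FiniteDimensional ℝ E] (h3 : 3 ≤ Module.finrank ℝ E)
    {B : Set E} (hBc : IsClosed B) (hBconv : Convex ℝ B) (hB0 : (0 : E) ∈ interior B)
    (hsec : ∀ f : E →ₗ[ℝ] ℝ, f ≠ 0 → ∃ c, f c = 0 ∧ ∀ y ∈ B, f y = 0 → (2 : ℝ) • c - y ∈ B)
    {μ : ℝ} (hμ1 : 1 < μ)
    (hμ : ∀ y ∈ B, -(μ⁻¹ • y) ∈ B) {u : E →ₗ[ℝ] ℝ} (hu : ∀ y ∈ B, u y ≤ 1) {x : E}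
    (hx : x ∈ B) (hx' : -(μ • x) ∈ B) (hux : u x = 1)
    (hmax : ∀ w ∈ B, -(μ • w) ∈ B → u w = 1 → ‖w‖ ≤ ‖x‖) :
    ∃ a : E, a ≠ 0 ∧ ∀ y ∈ B, (2 : ℝ) • a - y ∈ B := by
  have hx0 : x ≠ 0 := by rintro rfl; simp at hux
  suffices hs : ∀ y ∈ B, (1 - μ) • x - y ∈ B by
    refine ⟨((1 - μ) / 2) • x, smul_ne_zero (by linarith) hx0, fun y hy => ?_⟩
    convert hs y hy using 2
    rw [smul_smul]; congr 1; ring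
  have key : ∀ f : E →ₗ[ℝ] ℝ, f ≠ 0 → f x = 0 → ∃ z, f z = 0 ∧ u z = 1 ∧ z ∈ B ∧ -(μ • z) ∈ B ∧
      ∀ y ∈ B, f y = 0 → (1 - μ) • z - y ∈ B := fun f hf hfx =>
    exists_contact_point_of_section hBc hμ1 hμ hu hx hx' hux hfx (hsec f hf)
  let ψ : E →ₗ[ℝ] ℝ := (innerₛₗ ℝ x) - (‖x‖ ^ 2) • u
  have hψ : ∀ w, ψ w = inner ℝ x w - ‖x‖ ^ 2 * u w := fun w => by simp [ψ]
  have hψx : ψ x = 0 := by rw [hψ, hux]; simp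
  have hψX : ∀ w ∈ B, -(μ • w) ∈ B → u w = 1 → 0 ≤ ψ w → w = x := by
    intro w hw hw' huw h0
    have h1 := hmax w hw hw' huw
    have h2 : ‖x - w‖ ^ 2 = ‖x‖ ^ 2 - 2 * inner ℝ x w + ‖w‖ ^ 2 := norm_sub_sq_real x w
    rw [hψ, huw] at h0
    have h3 : ‖w‖ ^ 2 ≤ ‖x‖ ^ 2 := by gcongr
    have h4 : ‖x - w‖ = 0 := by
      have : ‖x - w‖ ^ 2 ≤ 0 := by linarith
      exact pow_eq_zero_iff (two_ne_zero) |>.1 (le_antisymm this (sq_nonneg _))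
    exact (sub_eq_zero.1 (norm_eq_zero.1 h4)).symm
  by_cases hcase : ∀ z ∈ B, u z = 1 → ψ z ≤ 0
  · intro y hy
    obtain ⟨f, hf, hfx, hfy⟩ := exists_linear_vanishing_pair h3 x y
    obtain ⟨z, hfz, huz, hzB, hzB', hz⟩ := key f hf hfx
    have h1 := hcase _ (hz _ hx' (by simp [hfx])) (by simp [hux, huz])
    simp only [map_sub, map_neg, map_smul, hψx, smul_eq_mul] at h1
    have h2 : z = x := hψX z hzB hzB' huz (by nlinarith)
    rw [← h2]; exact hz y hy hfy
  · push Not at hcase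
    obtain ⟨z, hzB, huz, hψz⟩ := hcase
    have hψ0 : ψ ≠ 0 := by
      rintro h; rw [h] at hψz; simp at hψz
    obtain ⟨x', hψx', hux', hxB', hxB'', hx''⟩ := key ψ hψ0 hψx
    have hxx : x' = x := hψX x' hxB' hxB'' hux' hψx'.ge
    rw [hxx] at hx''
    have huniq : ∀ w ∈ B, u w = 1 → ψ w = 0 → w = x := by
      intro w hw huw hψw
      have h1 := hx'' w hw hψw
      have h2 := hμ _ h1
      have h3 : -(μ⁻¹ • ((1 - μ) • x - w)) = x := by
        refine hψX _ h2 ?_ ?_ ?_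
        · convert h1 using 1
          rw [smul_neg, neg_neg, smul_smul, mul_inv_cancel₀ (by linarith), one_smul]
        · simp only [map_neg, map_smul, map_sub, hux, huw, smul_eq_mul]
          have : μ ≠ 0 := by linarith
          field_simp; ring
        · simp [hψx, hψw]
      have h4 : μ • x = -((1 - μ) • x - w) := by
        conv_lhs => rw [← h3]
        rw [smul_neg, smul_smul, mul_inv_cancel₀ (by linarith), one_smul]
      have : w = μ • x + (1 - μ) • x := by rw [h4]; abel
      rw [this]; module
    have hgood : ∀ y ∈ B, y ∉ Submodule.span ℝ {x, z} → (1 - μ) • x - y ∈ B := by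
      intro y hy hyspan
      have hz' : z ∉ Submodule.span ℝ {x, y} := by
        intro hz
        rw [Submodule.mem_span_pair] at hz
        obtain ⟨α, β, hz⟩ := hz
        by_cases hβ : β = 0
        · have h1 : z = α • x := by rw [← hz, hβ]; simp
          rw [h1] at hψz
          simp [hψx] at hψz
        · apply hyspan
          rw [Submodule.mem_span_pair]
          refine ⟨-(β⁻¹ * α), β⁻¹, ?_⟩
          rw [← hz, smul_add, smul_smul, smul_smul, inv_mul_cancel₀ hβ]
          module
      obtain ⟨f, hfz, hle⟩ := Submodule.exists_le_ker_of_notMem hz'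
      have hfx : f x = 0 := hle (Submodule.subset_span (by simp))
      have hfy : f y = 0 := hle (Submodule.subset_span (by simp))
      obtain ⟨w, hfw, huw, hwB, hwB', hw⟩ := key f (by rintro rfl; simp at hfz) hfx
      have hwx : w = x := by
        by_contra hne
        have hψw : ψ w < 0 := by
          by_contra! h
          exact hne (hψX w hwB hwB' huw h)
        have hd : 0 < ψ z - ψ w := by linarith
        set t := ψ z / (ψ z - ψ w)
        set s := -ψ w / (ψ z - ψ w) with hs
        have hts : s + t = 1 := by simp only [s, t]; field_simp; ring
        have hs0 : 0 < s := div_pos (by linarith) hd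
        have h1 := huniq (s • z + t • w) (hBconv hzB hwB hs0.le (by positivity) hts)
          (by simp [huz, huw, hts]) (by
            simp only [map_add, map_smul, smul_eq_mul, s, t]; field_simp; ring)
        have h2 : f (s • z + t • w) = 0 := by rw [h1, hfx]
        simp only [map_add, map_smul, hfw, smul_eq_mul, mul_zero, add_zero] at h2
        exact hfz ((mul_eq_zero.1 h2).resolve_left hs0.ne')
      rw [← hwx]; exact hw y hy hfy
    intro y hy
    by_cases hyspan : y ∉ Submodule.span ℝ {x, z}
    · exact hgood y hy hyspan
    push Not at hyspan
    obtain ⟨w, hw⟩ := exists_notMem_span_pair h3 x z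
    have hev : ∀ᶠ t : ℝ in nhdsWithin 0 (Set.Ioi 0), t • w ∈ B := by
      have : Filter.Tendsto (fun t : ℝ => t • w) (nhdsWithin 0 (Set.Ioi 0)) (nhds 0) := by
        have h : Continuous (fun t : ℝ => t • w) := by fun_prop
        simpa using (h.tendsto 0).mono_left nhdsWithin_le_nhds
      exact this.eventually (mem_interior_iff_mem_nhds.1 hB0)
    obtain ⟨t₀, ht₀B, ht₀⟩ := (hev.and self_mem_nhdsWithin).exists
    have ht₀' : t₀ ≠ 0 := ne_of_gt ht₀
    have hlim : Filter.Tendsto (fun t : ℝ => (1 - μ) • x - ((1 - t) • y + t • (t₀ • w)))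
        (nhdsWithin 0 (Set.Ioo 0 1)) (nhds ((1 - μ) • x - y)) := by
      have h : Continuous (fun t : ℝ => (1 - μ) • x - ((1 - t) • y + t • (t₀ • w))) := by fun_prop
      simpa using (h.tendsto 0).mono_left nhdsWithin_le_nhds
    have : (nhdsWithin (0:ℝ) (Set.Ioo 0 1)).NeBot := by
      rw [nhdsWithin_Ioo_eq_nhdsGT one_pos]; infer_instance
    refine hBc.mem_of_tendsto hlim ?_
    filter_upwards [self_mem_nhdsWithin] with t ht
    refine hgood _ (hBconv hy ht₀B (by linarith [ht.2]) ht.1.le (by ring)) fun hmem => hw ?_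
    have h1 := (Submodule.span ℝ {x, z}).sub_mem hmem
      ((Submodule.span ℝ {x, z}).smul_mem (1 - t) hyspan)
    rw [add_sub_cancel_left, smul_smul] at h1
    exact ((Submodule.span ℝ {x, z}).smul_mem_iff (mul_ne_zero ht.1.ne' ht₀')).1 h1

/-- If all hyperplane sections through an interior point `0` of a convex body are centrally
symmetric, then the body itself is centrally symmetric. -/
lemma symmetric_or_exists_center [FiniteDimensional ℝ E] (h3 : 3 ≤ Module.finrank ℝ E)
    {B : Set E} (hBc : IsCompact B) (hBconv : Convex ℝ B) (hB0 : (0 : E) ∈ interior B)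
    (hsec : ∀ f : E →ₗ[ℝ] ℝ, f ≠ 0 → ∃ c, f c = 0 ∧ ∀ y ∈ B, f y = 0 → (2 : ℝ) • c - y ∈ B) :
    (∀ y ∈ B, -y ∈ B) ∨ ∃ a : E, a ≠ 0 ∧ ∀ y ∈ B, (2 : ℝ) • a - y ∈ B := by
  have hBn : B ∈ nhds (0 : E) := mem_interior_iff_mem_nhds.1 hB0
  have habs : Absorbent ℝ B := absorbent_nhds_zero hBn
  have hcont : Continuous (gauge B) := continuous_gauge hBconv hBn
  have hmem : ∀ y, y ∈ B ↔ gauge B y ≤ 1 := fun y => by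
    rw [gauge_le_one_iff_mem_closure hBconv hBn, hBc.isClosed.closure_eq]
  obtain ⟨y₀, hy₀, hmax⟩ := hBc.exists_isMaxOn ⟨0, interior_subset hB0⟩
    (f := fun y => gauge B (-y)) (by fun_prop)
  set μ := gauge B (-y₀) with hμdef
  have hle : ∀ y ∈ B, gauge B (-y) ≤ μ := fun y hy => hmax hy
  rcases le_or_gt μ 1 with hμ1 | hμ1
  · exact Or.inl fun y hy => (hmem _).2 ((hle y hy).trans hμ1)
  right
  have hμ0 : 0 < μ := by linarith
  have hμB : ∀ y ∈ B, -(μ⁻¹ • y) ∈ B := by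
    intro y hy
    rw [hmem, ← smul_neg, gauge_smul_of_nonneg (by positivity), smul_eq_mul,
      inv_mul_le_iff₀ hμ0, mul_one]
    exact hle y hy
  let X : Set E := {z | z ∈ B ∧ -(μ • z) ∈ B ∧ gauge B z = 1}
  have hXc : IsCompact X := by
    have h2 : IsClosed {z : E | -(μ • z) ∈ B ∧ gauge B z = 1} :=
      (hBc.isClosed.preimage (by fun_prop : Continuous fun z : E => -(μ • z))).inter
        (isClosed_eq hcont continuous_const)
    exact hBc.inter_right h2
  have hXne : X.Nonempty := by
    refine ⟨-(μ⁻¹ • y₀), hμB y₀ hy₀, ?_, ?_⟩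
    · rw [smul_neg, neg_neg, smul_smul, mul_inv_cancel₀ hμ0.ne', one_smul]; exact hy₀
    · rw [← smul_neg, gauge_smul_of_nonneg (by positivity), ← hμdef, smul_eq_mul,
        inv_mul_cancel₀ hμ0.ne']
  obtain ⟨x, ⟨hx, hx', hx1⟩, hxmax⟩ := hXc.exists_isMaxOn hXne (f := fun z => ‖z‖) (by fun_prop)
  have hxint : x ∉ interior B := by
    intro h
    rw [← gauge_lt_one_iff_mem_interior hBconv hBn, hx1] at h
    exact lt_irrefl _ h
  obtain ⟨v, hv⟩ := geometric_hahn_banach_open_point hBconv.interior isOpen_interior hxint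
  have hvx : 0 < v x := by simpa using hv 0 hB0
  have hvB : ∀ y ∈ B, v y ≤ v x := by
    intro y hy
    have h1 : y ∈ closure (interior B) := by
      rw [hBconv.closure_interior_eq_closure_of_nonempty_interior ⟨0, hB0⟩]
      exact subset_closure hy
    have h2 : IsClosed {y | v y ≤ v x} := isClosed_le v.continuous continuous_const
    exact closure_minimal (fun z hz => (hv z hz).le) h2 h1
  refine exists_center_of_extremal_chord h3 hBc.isClosed hBconv hB0 hsec hμ1 hμB
    (u := (v x)⁻¹ • (v : E →ₗ[ℝ] ℝ)) ?_ hx hx' ?_ ?_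
  · intro y hy
    simpa [inv_mul_le_iff₀ hvx] using hvB y hy
  · simp [hvx.ne']
  · intro w hw hw' huw
    refine hxmax ⟨hw, hw', le_antisymm ((hmem w).1 hw) ?_⟩
    by_contra! h
    rw [gauge_lt_one_iff_mem_interior hBconv hBn] at h
    have := hv w h
    simp only [LinearMap.smul_apply, smul_eq_mul] at huw
    rw [inv_mul_eq_one₀ hvx.ne'] at huw
    exact absurd huw (by simpa using this.ne')

end FalseCenterExists

section FalseCenterNorm

variable {V : Type*} [NormedAddCommGroup V] [NormedSpace ℝ V]

lemma norm_le_one_of_section {a : V} (ha : ‖a‖ < 1) {f : V →ₗ[ℝ] ℝ} {c : V}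
    (hc : ∀ x, ‖x‖ ≤ 1 → f x = f a → ‖(2 : ℝ) • c - x‖ ≤ 1) {x : V} (hfx : f x = f a) {t : ℝ}
    (ht : 0 ≤ t) (hx : ‖x + t • c‖ < 1) : ‖x‖ ≤ 1 := by
  by_contra! hx1
  obtain ⟨θ, hθ, hθ1⟩ : ∃ θ ∈ Set.Icc (0 : ℝ) 1, ‖a + θ • (x - a)‖ = 1 := by
    have hcont : Continuous fun θ : ℝ => ‖a + θ • (x - a)‖ := by fun_prop
    have := intermediate_value_Icc zero_le_one hcont.continuousOn
    exact this ⟨by simpa using ha.le, by simpa using hx1.le⟩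
  set x' := a + θ • (x - a) with hx'
  have h1 := hc x' hθ1.le (by rw [hx', map_add, map_smul, map_sub, hfx]; simp)
  have hs : ‖x' + (θ * t) • c‖ < 1 := by
    have : x' + (θ * t) • c = (1 - θ) • a + θ • (x + t • c) := by rw [hx']; module
    rw [this]
    refine (norm_add_le _ _).trans_lt ?_
    rw [norm_smul, norm_smul, Real.norm_of_nonneg hθ.1, Real.norm_of_nonneg (by linarith [hθ.2])]
    rcases hθ.1.eq_or_lt with h0 | h0
    · rw [← h0]; simpa using ha
    · nlinarith [hθ.2]
  have h2 : (2 + θ * t) • x' = (2 : ℝ) • (x' + (θ * t) • c) - (θ * t) • ((2 : ℝ) • c - x') := by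
    module
  have hθt : 0 ≤ θ * t := mul_nonneg hθ.1 ht
  have h3 := norm_sub_le ((2 : ℝ) • (x' + (θ * t) • c)) ((θ * t) • ((2 : ℝ) • c - x'))
  rw [← h2, norm_smul, norm_smul, norm_smul, hθ1, Real.norm_of_nonneg hθt,
    Real.norm_of_nonneg (by positivity : (0 : ℝ) ≤ 2 + θ * t), Real.norm_two] at h3
  nlinarith

variable [FiniteDimensional ℝ V]

lemma section_center_nonneg {a : V} {h : ℝ} (hh : 1 < h) (ha : h * ‖a‖ = 1) {u : V →ₗ[ℝ] ℝ}
    (hu : ∀ x, |u x| ≤ h * ‖x‖) (hua : u a = 1) {f : V →ₗ[ℝ] ℝ} {c : V} (hfc : f c = f a)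
    (hc : ∀ x, ‖x‖ ≤ 1 → f x = f a → ‖(2 : ℝ) • c - x‖ ≤ 1) : 0 ≤ u c := by
  have hK : IsCompact {x : V | ‖x‖ ≤ 1 ∧ f x = f a} := by
    have h1 : IsClosed {x : V | f x = f a} :=
      isClosed_eq f.continuous_of_finiteDimensional continuous_const
    have h2 : {x : V | ‖x‖ ≤ 1 ∧ f x = f a} = closedBall 0 1 ∩ {x | f x = f a} := by
      ext x; simp
    rw [h2]
    exact (isCompact_closedBall 0 1).inter_right h1
  have ha1 : ‖a‖ ≤ 1 := by nlinarith [norm_nonneg a]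
  obtain ⟨x, ⟨hx1, hfx⟩, hmin⟩ := hK.exists_isMinOn ⟨a, ha1, rfl⟩
    u.continuous_of_finiteDimensional.continuousOn
  set k := (h - 1) / (h + 1) with hk
  have hp : 0 < h + 1 := by linarith
  have hk0 : 0 ≤ k := div_nonneg (by linarith) hp.le
  have hk1 : 0 < 1 - k := by rw [hk, sub_pos, div_lt_one hp]; linarith
  have hkh : k * (h + 1) = h - 1 := by rw [hk]; field_simp
  have hx' : ‖(1 - k) • (h • a) - k • x‖ ≤ 1 := by
    refine (norm_sub_le _ _).trans ?_
    rw [norm_smul, norm_smul, norm_smul, Real.norm_of_nonneg hk0, Real.norm_of_nonneg hk1.le,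
      Real.norm_of_nonneg (by linarith : 0 ≤ h), ha]
    nlinarith
  have hfx' : f ((1 - k) • (h • a) - k • x) = f a := by
    simp only [map_sub, map_smul, smul_eq_mul, hfx]
    linear_combination -f a * hkh
  have h1 : u x ≤ u ((2 : ℝ) • c - ((1 - k) • (h • a) - k • x)) :=
    isMinOn_iff.1 hmin _ ⟨hc _ hx' hfx', by
      rw [map_sub, map_smul, smul_eq_mul, hfc, hfx']; ring⟩
  simp only [map_sub, map_smul, smul_eq_mul, hua] at h1
  have h2 := (abs_le.1 (hu x)).1
  have h3 : 0 ≤ u x + h := by nlinarith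
  nlinarith [mul_nonneg hk1.le h3]

lemma exists_direction_nonneg {a : V} {h : ℝ} (hh : 1 < h) (ha : h * ‖a‖ = 1) {u : V →ₗ[ℝ] ℝ}
    (hu : ∀ x, |u x| ≤ h * ‖x‖) (hua : u a = 1)
    (hsec : ∀ f : V →ₗ[ℝ] ℝ, ∃ c, f c = f a ∧
      ∀ x, ‖x‖ ≤ 1 → f x = f a → ‖(2 : ℝ) • c - x‖ ≤ 1)
    {f : V →ₗ[ℝ] ℝ} (hf : f ≠ 0) (hfa : f a = 0) :
    ∃ v, f v = 1 ∧ 0 ≤ u v ∧ ∀ x, f x = 0 → ∀ t : ℝ, ‖x‖ ≤ ‖x + t • v‖ := by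
  have ha1 : ‖a‖ < 1 := by nlinarith [norm_nonneg a]
  obtain ⟨k, hfk, huk⟩ : ∃ k, f k = 1 ∧ u k = 0 := by
    obtain ⟨k, hk⟩ : ∃ w, f w ≠ 0 := by
      by_contra! h
      exact hf (LinearMap.ext h)
    refine ⟨(f k)⁻¹ • (k - u k • a), by simp [hfa, hk], by simp [hua]⟩
  choose c hc1 hc2 using fun s : ℝ => hsec (f + s • u)
  simp only [LinearMap.add_apply, LinearMap.smul_apply, smul_eq_mul, hfa, hua, mul_one,
    zero_add] at hc1
  have huc : ∀ s, 0 ≤ u (c s) := fun s =>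
    section_center_nonneg hh ha hu hua (f := f + s • u) (by simp [hc1, hfa, hua]) (hc2 s)
  have hc0 : ∀ s, s ≠ 0 → c s ≠ 0 := by
    rintro s hs h0
    have := hc1 s
    rw [h0] at this
    simp at this
    exact hs this.symm
  let s : ℕ → ℝ := fun n => 1 / ((n : ℝ) + 1)
  have hs0 : ∀ n, 0 < s n := fun n => Nat.one_div_pos_of_nat
  have hslim : Filter.Tendsto s Filter.atTop (nhds 0) := tendsto_one_div_add_atTop_nhds_zero_nat
  have hcpos : ∀ n, 0 < ‖c (s n)‖ := fun n => norm_pos_iff.2 (hc0 _ (hs0 n).ne')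
  let w : ℕ → V := fun n => (‖c (s n)‖)⁻¹ • c (s n)
  have hw1 : ∀ n, ‖w n‖ = 1 := fun n => by
    simp only [w]
    rw [norm_smul, norm_inv, norm_norm, inv_mul_cancel₀ (hcpos n).ne']
  obtain ⟨v, -, φ, hφ, hv⟩ := tendsto_subseq_of_bounded (x := w)
    (Metric.isBounded_closedBall (x := (0 : V)) (r := 1)) (fun n => by simp [hw1])
  have hsφ : Filter.Tendsto (fun n => s (φ n)) Filter.atTop (nhds 0) :=
    hslim.comp hφ.tendsto_atTop
  have hv1 : ‖v‖ = 1 := by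
    refine tendsto_nhds_unique hv.norm ?_
    simp [hw1]
  have hfcont : Continuous f := f.continuous_of_finiteDimensional
  have hucont : Continuous u := u.continuous_of_finiteDimensional
  have huv : 0 ≤ u v := by
    refine ge_of_tendsto' ((hucont.tendsto v).comp hv) fun n => ?_
    simp only [Function.comp_apply, w, map_smul, smul_eq_mul]
    exact mul_nonneg (by positivity) (huc _)
  have hunit : ∀ x, f x = 0 → ∀ t : ℝ, 0 ≤ t → ‖x + t • v‖ < 1 → ‖x‖ ≤ 1 := by
    intro x hx t ht hlt
    have l1 : Filter.Tendsto (fun n => x + (s (φ n) * (1 - u x)) • k) Filter.atTop (nhds x) := by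
      simpa using ((hsφ.mul_const (1 - u x)).smul_const k).const_add x
    have l2 : Filter.Tendsto (fun n => ‖x + (s (φ n) * (1 - u x)) • k + t • w (φ n)‖)
        Filter.atTop (nhds ‖x + t • v‖) := (l1.add (hv.const_smul t)).norm
    refine le_of_tendsto l1.norm ?_
    filter_upwards [l2.eventually (gt_mem_nhds hlt)] with n hn
    refine norm_le_one_of_section ha1 (hc2 (s (φ n))) (t := t * (‖c (s (φ n))‖)⁻¹) ?_
      (by positivity) ?_
    · simp only [LinearMap.add_apply, LinearMap.smul_apply, map_add, map_smul, smul_eq_mul, hfa,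
        hua, hx, hfk, huk]
      ring
    · simpa [w, smul_smul] using hn
  have hpos : ∀ x, f x = 0 → ∀ t : ℝ, 0 ≤ t → ‖x‖ ≤ ‖x + t • v‖ := by
    intro x hx t ht
    by_contra! hlt
    obtain ⟨ρ, hρ1, hρ2⟩ := exists_between hlt
    have hρ0 : 0 < ρ := (norm_nonneg _).trans_lt hρ1
    have h1 := hunit (ρ⁻¹ • x) (by simp [hx]) (ρ⁻¹ * t) (by positivity) (by
      rw [mul_smul, ← smul_add, norm_smul, norm_inv, Real.norm_of_nonneg hρ0.le,
        inv_mul_lt_iff₀ hρ0, mul_one]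
      exact hρ1)
    rw [norm_smul, norm_inv, Real.norm_of_nonneg hρ0.le, inv_mul_le_iff₀ hρ0, mul_one] at h1
    linarith
  have hall : ∀ x, f x = 0 → ∀ t : ℝ, ‖x‖ ≤ ‖x + t • v‖ := by
    intro x hx t
    rcases le_total 0 t with ht | ht
    · exact hpos x hx t ht
    · have := hpos (-x) (by simp [hx]) (-t) (by linarith)
      rwa [neg_smul, ← neg_add, norm_neg, norm_neg] at this
  have hfv0 : f v ≠ 0 := by
    intro h0
    have := hall v h0 (-1)
    simp [hv1] at this
    linarith
  have hfv : 0 ≤ f v := by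
    have l1 : Filter.Tendsto (fun n => f (w (φ n)) + s (φ n) * u (w (φ n))) Filter.atTop
        (nhds (f v)) := by
      have := ((hfcont.tendsto v).comp hv).add (hsφ.mul ((hucont.tendsto v).comp hv))
      simpa using this
    refine ge_of_tendsto' l1 fun n => ?_
    have h1 : f (w (φ n)) + s (φ n) * u (w (φ n)) = (‖c (s (φ n))‖)⁻¹ * s (φ n) := by
      simp only [w, map_smul, smul_eq_mul]
      linear_combination (‖c (s (φ n))‖)⁻¹ * hc1 (s (φ n))
    rw [h1]
    exact mul_nonneg (by positivity) (hs0 _).le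
  refine ⟨(f v)⁻¹ • v, by simp [hfv0], by simpa using mul_nonneg (inv_nonneg.2 hfv) huv,
    fun x hx t => ?_⟩
  rw [smul_smul]
  exact hall x hx _

lemma exists_direction {a : V} {h : ℝ} (hh : 1 < h) (ha : h * ‖a‖ = 1) {u : V →ₗ[ℝ] ℝ}
    (hu : ∀ x, |u x| ≤ h * ‖x‖) (hua : u a = 1)
    (hsec : ∀ f : V →ₗ[ℝ] ℝ, ∃ c, f c = f a ∧
      ∀ x, ‖x‖ ≤ 1 → f x = f a → ‖(2 : ℝ) • c - x‖ ≤ 1)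
    {f : V →ₗ[ℝ] ℝ} (hf : f ≠ 0) (hfa : f a = 0) :
    ∃ v, f v = 1 ∧ u v = 0 ∧ ∀ x, ‖x - f x • v‖ ≤ ‖x‖ := by
  obtain ⟨v, hfv, huv, hv⟩ := exists_direction_nonneg hh ha hu hua hsec hf hfa
  obtain ⟨v', hfv', huv', hv'⟩ :=
    exists_direction_nonneg hh ha hu hua hsec (neg_ne_zero.2 hf) (by simp [hfa])
  simp only [LinearMap.neg_apply] at hfv' hv'
  have k1 : ∀ x, ‖x - f x • v‖ ≤ ‖x‖ := fun x => by
    have := hv (x - f x • v) (by simp [hfv]) (f x)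
    rwa [sub_add_cancel] at this
  have k2 : ∀ x, ‖x + f x • v'‖ ≤ ‖x‖ := fun x => by
    have := hv' (x + f x • v') (by simp; linear_combination f x * hfv') (-f x)
    rwa [neg_smul, add_neg_cancel_right] at this
  rcases (add_nonneg huv huv').eq_or_lt with h0 | h0
  · exact ⟨v, hfv, by linarith, k1⟩
  refine ⟨(u v' / (u v + u v')) • v - (u v / (u v + u v')) • v', ?_, ?_, fun x => ?_⟩
  · simp only [map_sub, map_smul, smul_eq_mul, hfv, show f v' = -1 by linarith]
    field_simp
    ring
  · simp only [map_sub, map_smul, smul_eq_mul]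
    field_simp
    ring
  · have hpq : u v' / (u v + u v') + u v / (u v + u v') = 1 := by field_simp; ring
    have hp : 0 ≤ u v' / (u v + u v') := by positivity
    have hq : 0 ≤ u v / (u v + u v') := by positivity
    generalize u v' / (u v + u v') = p at *
    generalize u v / (u v + u v') = q at *
    obtain rfl : p = 1 - q := by linarith
    have h1 : x - f x • ((1 - q) • v - q • v') =
        (1 - q) • (x - f x • v) + q • (x + f x • v') := by
      module
    rw [h1]
    refine (norm_add_le _ _).trans ?_
    rw [norm_smul, norm_smul, Real.norm_of_nonneg hp, Real.norm_of_nonneg hq]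
    linarith [mul_le_mul_of_nonneg_left (k1 x) hp, mul_le_mul_of_nonneg_left (k2 x) hq]

/-- Every subspace through the false center is the image of a norm-one projection. -/
lemma exists_contractive_projection {a : V} {h : ℝ} (hh : 1 < h) (ha : h * ‖a‖ = 1)
    {u : V →ₗ[ℝ] ℝ} (hu : ∀ x, |u x| ≤ h * ‖x‖) (hua : u a = 1)
    (hsec : ∀ f : V →ₗ[ℝ] ℝ, ∃ c, f c = f a ∧
      ∀ x, ‖x‖ ≤ 1 → f x = f a → ‖(2 : ℝ) • c - x‖ ≤ 1) (W : Submodule ℝ V) (haW : a ∈ W) :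
    ∃ P : V →ₗ[ℝ] V, (∀ w ∈ W, P w = w) ∧ (∀ x, P x ∈ W) ∧ (∀ x, ‖P x‖ ≤ ‖x‖) ∧
      ∀ x, u (P x) = u x := by
  induction W using WellFoundedGT.induction with
  | ind W ih =>
    by_cases hW : W = ⊤
    · exact ⟨LinearMap.id, by simp, by simp [hW], by simp, by simp⟩
    obtain ⟨y, -, hy⟩ := SetLike.exists_of_lt (lt_top_iff_ne_top.2 hW)
    have hlt : W < W ⊔ Submodule.span ℝ {y} := by
      refine lt_of_le_of_ne le_sup_left fun h => hy ?_
      rw [h]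
      exact Submodule.mem_sup_right (Submodule.mem_span_singleton_self y)
    obtain ⟨P, hP1, hP2, hP3, hP4⟩ := ih _ hlt (hlt.le haW)
    obtain ⟨φ, hφy, hφW⟩ := Submodule.exists_le_ker_of_notMem hy
    have hφW : ∀ w ∈ W, φ w = 0 := fun w hw => hφW hw
    have hPy : P y = y := hP1 y (Submodule.mem_sup_right (Submodule.mem_span_singleton_self y))
    obtain ⟨v, hfv, huv, hv⟩ := exists_direction hh ha hu hua hsec (f := φ ∘ₗ P)
      (fun h0 => hφy (by rw [← hPy]; exact LinearMap.congr_fun h0 y))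
      (by rw [LinearMap.comp_apply, hP1 a (hlt.le haW), hφW a haW])
    simp only [LinearMap.comp_apply] at hfv hv
    refine ⟨P ∘ₗ (LinearMap.id - (φ ∘ₗ P).smulRight v), fun w hw => ?_, fun x => ?_, fun x => ?_,
      fun x => ?_⟩
    · simp [hP1 w (hlt.le hw), hφW w hw]
    · simp only [LinearMap.comp_apply, LinearMap.sub_apply, LinearMap.id_apply,
        LinearMap.smulRight_apply]
      have h1 : φ (P (x - φ (P x) • v)) = 0 := by simp [hfv]
      obtain ⟨w, hw, z, hz, hwz⟩ := Submodule.mem_sup.1 (hP2 (x - φ (P x) • v))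
      obtain ⟨t, rfl⟩ := Submodule.mem_span_singleton.1 hz
      rw [← hwz, map_add, hφW w hw, map_smul, zero_add, smul_eq_mul] at h1
      rw [← hwz, (mul_eq_zero.1 h1).resolve_right hφy]
      simpa using hw
    · exact (hP3 _).trans (hv x)
    · simp [hP4, huv]

lemma exists_coordinate {a : V} {h : ℝ} (hh : 1 < h) (ha : h * ‖a‖ = 1)
    {u : V →ₗ[ℝ] ℝ} (hu : ∀ x, |u x| ≤ h * ‖x‖) (hua : u a = 1)
    (hsec : ∀ f : V →ₗ[ℝ] ℝ, ∃ c, f c = f a ∧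
      ∀ x, ‖x‖ ≤ 1 → f x = f a → ‖(2 : ℝ) • c - x‖ ≤ 1) {x : V} (hx : x ≠ 0) (hux : u x = 0) :
    ∃ n : V →ₗ[ℝ] ℝ, n x = 1 ∧ ∀ z : ℝ, ∀ y, u y = 0 → ‖z • a + n y • x‖ ≤ ‖z • a + y‖ := by
  have haW : a ∈ Submodule.span ℝ {a, x} := Submodule.subset_span (by simp)
  have hxW : x ∈ Submodule.span ℝ {a, x} := Submodule.subset_span (by simp)
  obtain ⟨P, hP1, hP2, hP3, hP4⟩ :=
    exists_contractive_projection hh ha hu hua hsec (Submodule.span ℝ {a, x}) haW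
  have hxa : x ∉ Submodule.span ℝ {a} := by
    intro hmem
    obtain ⟨t, rfl⟩ := Submodule.mem_span_singleton.1 hmem
    simp only [map_smul, hua, smul_eq_mul, mul_one] at hux
    simp [hux] at hx
  obtain ⟨χ, hχx, hχa⟩ := Submodule.exists_le_ker_of_notMem hxa
  have hχa : χ a = 0 := hχa (Submodule.mem_span_singleton_self a)
  refine ⟨(χ x)⁻¹ • (χ ∘ₗ P), by simp [hP1 x hxW, hχx], fun z y hy => ?_⟩
  have h1 : P y = ((χ x)⁻¹ * χ (P y)) • x := by
    obtain ⟨p, q, hpq⟩ := Submodule.mem_span_pair.1 (hP2 y)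
    have h2 := hP4 y
    rw [← hpq, hy] at h2
    simp only [map_add, map_smul, hua, hux, smul_eq_mul, mul_one, mul_zero, add_zero] at h2
    rw [← hpq, h2]
    simp only [zero_smul, zero_add, map_smul, smul_eq_mul]
    congr 1
    field_simp
  have h2 := hP3 (z • a + y)
  rw [map_add, map_smul, hP1 a haW, h1] at h2
  simpa using h2

end FalseCenterNorm

/-- Two positive functions with a common logarithmic subgradient are proportional. -/
lemma mul_le_mul_of_common_slope {φ ψ s : ℝ → ℝ} {M : ℝ} (hφ : ∀ t, 0 < φ t)
    (hψ : ∀ t, 0 < ψ t) (hM : ∀ t ∈ Set.Icc (0 : ℝ) 1, |s t| ≤ M)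
    (h1 : ∀ t t', φ t * (1 + (t' - t) * s t) ≤ φ t')
    (h2 : ∀ t t', ψ t * (1 + (t' - t) * s t) ≤ ψ t') : φ 0 * ψ 1 ≤ φ 1 * ψ 0 := by
  have hM0 : 0 ≤ M := (abs_nonneg _).trans (hM 0 (by simp))
  have key : ∀ K : ℕ, M < K → φ 0 / ψ 0 * ((1 - (K : ℝ)⁻¹ * M) * (1 - (K : ℝ)⁻¹ * M ^ 2)) ≤
      φ 1 / ψ 1 * (1 + (K : ℝ)⁻¹ * M) := by
    intro K hK
    have hK0 : (0 : ℝ) < K := hM0.trans_lt hK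
    obtain ⟨d, hd⟩ : ∃ d : ℝ, d = (K : ℝ)⁻¹ := ⟨_, rfl⟩
    have hd0 : 0 < d := by rw [hd]; positivity
    have hKd : K * d = 1 := by rw [hd]; field_simp
    have hdM : d * M < 1 := by
      rw [← hKd, mul_comm]
      exact mul_lt_mul_of_pos_right hK hd0
    rw [← hd]
    have hdM0 : 0 ≤ d * M := by positivity
    have hsq : 0 ≤ 1 - d ^ 2 * M ^ 2 := by nlinarith
    have hds : ∀ t ∈ Set.Icc (0 : ℝ) 1, |d * s t| ≤ d * M := fun t ht => by
      rw [abs_mul, abs_of_pos hd0]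
      exact mul_le_mul_of_nonneg_left (hM t ht) hd0.le
    have ind : ∀ k : ℕ, k ≤ K → φ 0 / ψ 0 * (1 - d * M) * (1 - d ^ 2 * M ^ 2) ^ k ≤
        φ (k * d) / ψ (k * d) * (1 + d * s (k * d)) := by
      intro k
      induction k with
      | zero =>
        intro _
        simp only [Nat.cast_zero, zero_mul, pow_zero, mul_one]
        have := (abs_le.1 (hds 0 (by simp))).1
        exact mul_le_mul_of_nonneg_left (by linarith) (div_pos (hφ _) (hψ _)).le
      | succ k ih =>
        intro hk
        have ih := ih (by omega)
        have hkr : ((k : ℝ) + 1) ≤ K := by exact_mod_cast hk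
        have ht : (k : ℝ) * d ∈ Set.Icc (0 : ℝ) 1 :=
          ⟨by positivity, by rw [← hKd]; nlinarith⟩
        have ht' : ((k : ℝ) + 1) * d ∈ Set.Icc (0 : ℝ) 1 :=
          ⟨by positivity, by rw [← hKd]; nlinarith⟩
        push_cast
        obtain ⟨t, htd⟩ : ∃ t, t = (k : ℝ) * d := ⟨_, rfl⟩
        obtain ⟨t', htd'⟩ : ∃ t', t' = ((k : ℝ) + 1) * d := ⟨_, rfl⟩
        rw [← htd] at ih ht
        rw [← htd'] at ht' ⊢
        have e1 := h1 t t'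
        have e2 := h2 t' t
        rw [show t' - t = d by rw [htd, htd']; ring] at e1
        rw [show t - t' = -d by rw [htd, htd']; ring] at e2
        have b1 := abs_le.1 (hds t ht)
        have b2 := abs_le.1 (hds t' ht')
        have e3 : φ t / ψ t * (1 + d * s t) * (1 - d * s t') ≤ φ t' / ψ t' := by
          rw [div_mul_eq_mul_div, div_mul_eq_mul_div, div_le_div_iff₀ (hψ _) (hψ _)]
          have p1 : 0 ≤ ψ t' * (1 - d * s t') := mul_nonneg (hψ _).le (by linarith)
          have p2 := mul_le_mul e1 (show ψ t' * (1 - d * s t') ≤ ψ t by linarith) p1 (hφ t').le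
          linarith
        have e4 : φ t / ψ t * (1 + d * s t) * (1 - (d * s t') ^ 2) ≤
            φ t' / ψ t' * (1 + d * s t') := by
          have := mul_le_mul_of_nonneg_right e3 (show 0 ≤ 1 + d * s t' by linarith)
          linarith
        have e5 : 1 - d ^ 2 * M ^ 2 ≤ 1 - (d * s t') ^ 2 := by
          have := sq_le_sq' b2.1 b2.2
          linarith
        have e6 : 0 ≤ φ t / ψ t * (1 + d * s t) :=
          mul_nonneg (div_pos (hφ _) (hψ _)).le (by linarith)
        calc _ = φ 0 / ψ 0 * (1 - d * M) * (1 - d ^ 2 * M ^ 2) ^ k * (1 - d ^ 2 * M ^ 2) := by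
              ring
          _ ≤ φ t / ψ t * (1 + d * s t) * (1 - d ^ 2 * M ^ 2) :=
              mul_le_mul_of_nonneg_right ih hsq
          _ ≤ _ := (mul_le_mul_of_nonneg_left e5 e6).trans e4
    have fin := ind K le_rfl
    rw [hKd] at fin
    have bern : 1 - d * M ^ 2 ≤ (1 - d ^ 2 * M ^ 2) ^ K := by
      have := one_add_mul_le_pow (a := -(d ^ 2 * M ^ 2)) (by linarith) K
      have e : (K : ℝ) * -(d ^ 2 * M ^ 2) = -(d * M ^ 2) := by
        linear_combination -(d * M ^ 2) * hKd
      rw [e] at this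
      simpa [sub_eq_add_neg] using this
    have b := (abs_le.1 (hds 1 (by simp))).2
    have c1 := mul_le_mul_of_nonneg_left bern
      (mul_nonneg (div_pos (hφ 0) (hψ 0)).le (show 0 ≤ 1 - d * M by linarith))
    have c2 := mul_le_mul_of_nonneg_left (show 1 + d * s 1 ≤ 1 + d * M by linarith)
      (div_pos (hφ 1) (hψ 1)).le
    linarith
  have l0 : Filter.Tendsto (fun K : ℕ => (K : ℝ)⁻¹) Filter.atTop (nhds 0) :=
    tendsto_inv_atTop_nhds_zero_nat
  have hle : φ 0 / ψ 0 ≤ φ 1 / ψ 1 := by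
    have l1 := (((l0.mul_const M).const_sub 1).mul ((l0.mul_const (M ^ 2)).const_sub 1)).const_mul
      (φ 0 / ψ 0)
    have l2 := ((l0.mul_const M).const_add 1).const_mul (φ 1 / ψ 1)
    simp only [zero_mul, sub_zero, add_zero, mul_one] at l1 l2
    refine le_of_tendsto_of_tendsto l1 l2 ?_
    obtain ⟨K₀, hK₀⟩ := exists_nat_gt M
    filter_upwards [Filter.eventually_ge_atTop K₀] with K hK
    exact key K (hK₀.trans_le (by exact_mod_cast hK))
  rwa [div_le_div_iff₀ (hψ _) (hψ _)] at hle

section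

variable {V : Type*} [NormedAddCommGroup V] [NormedSpace ℝ V]

lemma mul_gauge_le_gauge {K : Set V} (hK : K ∈ nhds 0) {u n : V →ₗ[ℝ] ℝ} {x : V}
    (hn : ∀ y ∈ K, u y = 0 → n y • x ∈ K) {y : V} (hy : u y = 0) :
    n y * gauge K x ≤ gauge K y := by
  rcases le_total (n y) 0 with h0 | h0
  · exact (mul_nonpos_of_nonpos_of_nonneg h0 (gauge_nonneg _)).trans (gauge_nonneg _)
  refine le_of_forall_gt fun r hr => ?_
  obtain ⟨b, hb, hbr, hyb⟩ := exists_lt_of_gauge_lt (absorbent_nhds_zero hK) hr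
  rw [Set.mem_smul_set_iff_inv_smul_mem₀ hb.ne'] at hyb
  have h1 := gauge_le_one_of_mem (hn _ hyb (by simp [hy]))
  rw [map_smul, smul_eq_mul, gauge_smul_of_nonneg (by positivity), smul_eq_mul, mul_assoc,
    inv_mul_le_iff₀ hb, mul_one] at h1
  linarith

lemma gauge_mul_norm_le {K : Set V} (hK : K ∈ nhds 0) (hKb : Bornology.IsBounded K)
    {u : V →ₗ[ℝ] ℝ}
    (hn : ∀ x, x ≠ 0 → u x = 0 → ∃ n : V →ₗ[ℝ] ℝ, n x = 1 ∧
      (∀ y ∈ K, u y = 0 → n y • x ∈ K) ∧ ∀ y, u y = 0 → ‖n y • x‖ ≤ ‖y‖)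
    {x y : V} (hx : u x = 0) (hy : u y = 0) (hxy : ∀ t : ℝ, x + t • (y - x) ≠ 0) :
    gauge K x * ‖y‖ ≤ gauge K y * ‖x‖ := by
  have hp : ∀ t : ℝ, u (x + t • (y - x)) = 0 := fun t => by simp [hx, hy]
  choose n hn1 hn2 hn3 using fun t : ℝ => hn _ (hxy t) (hp t)
  have hu : u (y - x) = 0 := by simp [hx, hy]
  have hexp : ∀ t t' : ℝ, n t (x + t' • (y - x)) = 1 + (t' - t) * n t (y - x) := by
    intro t t'
    have h1 := hn1 t
    rw [map_add, map_smul, smul_eq_mul] at h1 ⊢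
    linear_combination h1
  obtain ⟨t₀, -, ht₀⟩ := (isCompact_Icc (a := (0 : ℝ)) (b := 1)).exists_isMinOn
    ⟨0, by simp⟩ (f := fun t : ℝ => ‖x + t • (y - x)‖) (by fun_prop)
  have hpos : ∀ t : ℝ, 0 < ‖x + t • (y - x)‖ := fun t => norm_pos_iff.2 (hxy t)
  have := mul_le_mul_of_common_slope (φ := fun t => gauge K (x + t • (y - x)))
    (ψ := fun t => ‖x + t • (y - x)‖) (s := fun t => n t (y - x))
    (M := ‖y - x‖ / ‖x + t₀ • (y - x)‖) ?_ hpos ?_ ?_ ?_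
  · simpa using this
  · intro t
    exact (gauge_pos (absorbent_nhds_zero hK) ((NormedSpace.isVonNBounded_iff ℝ).2 hKb)).2 (hxy t)
  · intro t ht
    have h1 := hn3 t _ hu
    rw [norm_smul, Real.norm_eq_abs] at h1
    have h2 : ‖x + t₀ • (y - x)‖ ≤ ‖x + t • (y - x)‖ := ht₀ ht
    rw [le_div_iff₀ (hpos _)]
    exact (mul_le_mul_of_nonneg_left h2 (abs_nonneg _)).trans h1
  · intro t t'
    have := mul_gauge_le_gauge hK (hn2 t) (hp t')
    rw [hexp] at this
    linarith
  · intro t t'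
    have := hn3 t _ (hp t')
    rw [hexp, norm_smul] at this
    have h2 := mul_le_mul_of_nonneg_right (le_abs_self (1 + (t' - t) * n t (y - x)))
      (norm_nonneg (x + t • (y - x)))
    rw [← Real.norm_eq_abs] at h2
    linarith

lemma gauge_mul_norm_eq {K : Set V} (hK : K ∈ nhds 0) (hKb : Bornology.IsBounded K)
    {u : V →ₗ[ℝ] ℝ}
    (hn : ∀ x, x ≠ 0 → u x = 0 → ∃ n : V →ₗ[ℝ] ℝ, n x = 1 ∧
      (∀ y ∈ K, u y = 0 → n y • x ∈ K) ∧ ∀ y, u y = 0 → ‖n y • x‖ ≤ ‖y‖)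
    (hker : ∀ x, ∃ w, u w = 0 ∧ w ∉ Submodule.span ℝ {x})
    {x y : V} (hx : u x = 0) (hy : u y = 0) (hx0 : x ≠ 0) (hy0 : y ≠ 0) :
    gauge K x * ‖y‖ = gauge K y * ‖x‖ := by
  have aux : ∀ p q : V, p ≠ 0 → u p = 0 → u q = 0 → q ∉ Submodule.span ℝ {p} →
      gauge K p * ‖q‖ = gauge K q * ‖p‖ := by
    intro p q hp0 hp hq hpq
    have h1 : ∀ t : ℝ, p + t • (q - p) ≠ 0 := by
      intro t h0
      have ht : t ≠ 0 := by
        rintro rfl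
        simp [hp0] at h0
      refine hpq (Submodule.mem_span_singleton.2 ⟨1 - t⁻¹, ?_⟩)
      have : q = (1 - t⁻¹) • p + t⁻¹ • (p + t • (q - p)) := by
        simp only [smul_add, smul_sub, smul_smul, inv_mul_cancel₀ ht]
        module
      rw [h0, smul_zero, add_zero] at this
      exact this.symm
    refine le_antisymm (gauge_mul_norm_le hK hKb hn hp hq h1)
      (gauge_mul_norm_le hK hKb hn hq hp fun t h0 => h1 (1 - t) ?_)
    rw [← h0]
    module
  by_cases hxy : y ∈ Submodule.span ℝ {x}
  · obtain ⟨w, hw, hwx⟩ := hker x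
    have hwy : w ∉ Submodule.span ℝ {y} := fun hmem =>
      hwx ((Submodule.span_singleton_le_iff_mem y _).2 hxy hmem)
    have hw0 : 0 < ‖w‖ := norm_pos_iff.2 (by rintro rfl; simp at hwx)
    have h1 := aux x w hx0 hx hw hwx
    have h2 := aux y w hy0 hy hw hwy
    refine mul_right_cancel₀ hw0.ne' ?_
    linear_combination ‖y‖ * h1 - ‖x‖ * h2
  · exact aux x y hx0 hx hy hxy

end

section

variable {V : Type*} [NormedAddCommGroup V] [NormedSpace ℝ V] [FiniteDimensional ℝ V]

lemma exists_notMem_span_singleton_of_finrank (h3 : 3 ≤ Module.finrank ℝ V) (u : V →ₗ[ℝ] ℝ)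
    (x : V) : ∃ w, u w = 0 ∧ w ∉ Submodule.span ℝ {x} := by
  by_contra! hcon
  have h1 : LinearMap.ker u ≤ Submodule.span ℝ {x} := fun w hw => hcon w hw
  have h2 := (Submodule.finrank_mono h1).trans (finrank_span_le_card (R := ℝ) {x})
  simp only [Set.toFinset_singleton, Finset.card_singleton] at h2
  have h4 := LinearMap.finrank_range_add_finrank_ker u
  have h5 := Submodule.finrank_le (LinearMap.range u)
  rw [Module.finrank_self] at h5
  omega

/-- The sections of the unit ball parallel to `ker u` are homothetic. -/
lemma norm_smul_add_le_one_iff_of_norm_eq (h3 : 3 ≤ Module.finrank ℝ V) {a : V} {h : ℝ}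
    (hh : 1 < h) (ha : h * ‖a‖ = 1)
    {u : V →ₗ[ℝ] ℝ} (hu : ∀ x, |u x| ≤ h * ‖x‖) (hua : u a = 1)
    (hsec : ∀ f : V →ₗ[ℝ] ℝ, ∃ c, f c = f a ∧
      ∀ x, ‖x‖ ≤ 1 → f x = f a → ‖(2 : ℝ) • c - x‖ ≤ 1) {z : ℝ} (hz : |z| ≤ h) {y y' : V}
    (hy : u y = 0) (hy' : u y' = 0) (hyy' : ‖y‖ = ‖y'‖) (hle : ‖z • a + y‖ ≤ 1) :
    ‖z • a + y'‖ ≤ 1 := by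
  have h0 : 0 < h := by linarith
  have strict : ∀ z : ℝ, |z| < h → ∀ y y' : V, u y = 0 → u y' = 0 → ‖y‖ = ‖y'‖ →
      ‖z • a + y‖ ≤ 1 → ‖z • a + y'‖ ≤ 1 := by
    intro z hz y y' hy hy' hyy' hle
    rcases eq_or_ne y 0 with rfl | hy0
    · rw [norm_zero, eq_comm, norm_eq_zero] at hyy'
      rwa [hyy']
    have hy0' : y' ≠ 0 := norm_ne_zero_iff.1 (hyy' ▸ norm_ne_zero_iff.2 hy0)
    obtain ⟨K, hKdef⟩ : ∃ K : Set V, K = {w | ‖z • a + w‖ ≤ 1} := ⟨_, rfl⟩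
    have hKpre : K = (fun w => z • a + w) ⁻¹' closedBall 0 1 := by
      rw [hKdef]; ext w; simp [add_comm, dist_eq_norm]
    have hKconv : Convex ℝ K := by
      rw [hKpre]
      exact (convex_closedBall _ _).translate_preimage_right _
    have hKclosed : IsClosed K := by
      rw [hKpre]
      exact isClosed_closedBall.preimage (by fun_prop)
    have hza : ‖z • a‖ < 1 := by
      rw [norm_smul, Real.norm_eq_abs, ← ha]
      have : 0 < ‖a‖ := by
        by_contra! hc
        nlinarith
      exact mul_lt_mul_of_pos_right hz this
    have hKn : K ∈ nhds 0 := by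
      have : Filter.Tendsto (fun w => ‖z • a + w‖) (nhds 0) (nhds ‖z • a‖) := by
        have : Continuous fun w => ‖z • a + w‖ := by fun_prop
        simpa using this.tendsto 0
      filter_upwards [this.eventually (gt_mem_nhds hza)] with w hw
      rw [hKdef]
      exact hw.le
    have hKb : Bornology.IsBounded K := by
      refine (isBounded_closedBall (x := (0 : V)) (r := 1 + ‖z • a‖)).subset fun w hw => ?_
      rw [hKdef, Set.mem_ofPred_eq] at hw
      rw [mem_closedBall_zero_iff]
      have := norm_sub_le (z • a + w) (z • a)
      rw [add_sub_cancel_left] at this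
      linarith
    have heq := gauge_mul_norm_eq hKn hKb (u := u) (fun x hx hux => by
      obtain ⟨n, hn1, hn2⟩ := exists_coordinate hh ha hu hua hsec hx hux
      refine ⟨n, hn1, fun y hyK hy => ?_, fun y hy => by simpa using hn2 0 y hy⟩
      rw [hKdef] at hyK ⊢
      exact (hn2 z y hy).trans hyK) (exists_notMem_span_singleton_of_finrank h3 u)
      hy hy' hy0 hy0'
    rw [hyy'] at heq
    have hg := mul_right_cancel₀ (norm_ne_zero_iff.2 hy0') heq
    have hmem : ∀ w, gauge K w ≤ 1 ↔ ‖z • a + w‖ ≤ 1 := fun w => by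
      rw [gauge_le_one_iff_mem_closure hKconv hKn, hKclosed.closure_eq, hKdef, Set.mem_ofPred_eq]
    rw [← hmem, ← hg, hmem]
    exact hle
  by_contra! hcon
  obtain ⟨s, hs1, hs2⟩ := exists_between (inv_lt_one_of_one_lt₀ hcon)
  have hs0 : 0 < s := (by positivity : (0 : ℝ) ≤ ‖z • a + y'‖⁻¹).trans_lt hs1
  have h1 := strict (s * z) (by rw [abs_mul, abs_of_pos hs0]; nlinarith [abs_nonneg z])
    (s • y) (s • y') (by simp [hy]) (by simp [hy']) (by rw [norm_smul, norm_smul, hyy'])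
    (by
      rw [mul_smul, ← smul_add, norm_smul, Real.norm_of_nonneg hs0.le]
      nlinarith [norm_nonneg (z • a + y)])
  rw [mul_smul, ← smul_add, norm_smul, Real.norm_of_nonneg hs0.le] at h1
  rw [inv_lt_iff_one_lt_mul₀ (by linarith)] at hs1
  linarith

/-- A profile function describing the unit ball as a body of revolution. -/
lemma exists_profile (h3 : 3 ≤ Module.finrank ℝ V) {a : V} {h : ℝ}
    (hh : 1 < h) (ha : h * ‖a‖ = 1)
    {u : V →ₗ[ℝ] ℝ} (hu : ∀ x, |u x| ≤ h * ‖x‖) (hua : u a = 1)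
    (hsec : ∀ f : V →ₗ[ℝ] ℝ, ∃ c, f c = f a ∧
      ∀ x, ‖x‖ ≤ 1 → f x = f a → ‖(2 : ℝ) • c - x‖ ≤ 1) :
    ∃ G : ℝ → ℝ, G 0 = 1 ∧ (∀ z, |z| ≤ h → G (-z) = G z) ∧
      ConcaveOn ℝ (Set.Icc (-h) h) G ∧ (∀ z, |z| ≤ h → 0 ≤ G z) ∧ (∀ z, |z| < h → 0 < G z) ∧
      ∀ z, |z| ≤ h → ∀ y, u y = 0 → (‖z • a + y‖ ≤ 1 ↔ ‖y‖ ≤ G z) := by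
  have h0 : 0 < h := by linarith
  have inv := fun {z : ℝ} (hz : |z| ≤ h) {y y' : V} => norm_smul_add_le_one_iff_of_norm_eq h3 hh ha
    hu hua hsec hz (y := y) (y' := y')
  obtain ⟨w, hw, hw0⟩ := exists_notMem_span_singleton_of_finrank h3 u 0
  obtain ⟨e, hue, he⟩ : ∃ e, u e = 0 ∧ ‖e‖ = 1 := by
    have : ‖w‖ ≠ 0 := norm_ne_zero_iff.2 (by rintro rfl; simp at hw0)
    exact ⟨‖w‖⁻¹ • w, by simp [hw], by rw [norm_smul, norm_inv, norm_norm, inv_mul_cancel₀ this]⟩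
  have hza : ∀ z : ℝ, ‖z • a‖ = |z| / h := fun z => by
    rw [norm_smul, Real.norm_eq_abs, eq_div_iff h0.ne', mul_assoc, mul_comm ‖a‖, ha, mul_one]
  let S : ℝ → Set ℝ := fun z => {s | ‖z • a + s • e‖ ≤ 1}
  have hSb : ∀ z, BddAbove (S z) := fun z => by
    refine ⟨1 + ‖z • a‖, fun s hs => ?_⟩
    have h1 := norm_sub_le (z • a + s • e) (z • a)
    rw [add_sub_cancel_left, norm_smul, he, mul_one] at h1
    have h2 : ‖z • a + s • e‖ ≤ 1 := hs
    linarith [Real.le_norm_self s]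
  have hSclosed : ∀ z, IsClosed (S z) := fun z =>
    isClosed_le (by fun_prop) continuous_const
  have hSne : ∀ z, |z| ≤ h → (0 : ℝ) ∈ S z := fun z hz => by
    simp only [S, Set.mem_ofPred_eq, zero_smul, add_zero, hza]
    rwa [div_le_one h0]
  have hmem : ∀ z, |z| ≤ h → sSup (S z) ∈ S z := fun z hz =>
    (hSclosed z).csSup_mem ⟨0, hSne z hz⟩ (hSb z)
  have hnn : ∀ z, |z| ≤ h → 0 ≤ sSup (S z) := fun z hz => le_csSup (hSb z) (hSne z hz)
  have hiff : ∀ z, |z| ≤ h → ∀ y, u y = 0 → (‖z • a + y‖ ≤ 1 ↔ ‖y‖ ≤ sSup (S z)) := by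
    intro z hz y hy
    constructor
    · intro hle
      refine le_csSup (hSb z) (?_ : ‖z • a + ‖y‖ • e‖ ≤ 1)
      exact inv hz hy (by simp [hue]) (by rw [norm_smul, he, norm_norm, mul_one]) hle
    · intro hle
      rcases (norm_nonneg y).eq_or_lt with h1 | h1
      · rw [norm_eq_zero.1 h1.symm]
        rwa [add_zero, hza, div_le_one h0]
      have hG := h1.trans_le hle
      have h2 : ‖z • a + (sSup (S z) / ‖y‖) • y‖ ≤ 1 := by
        refine inv hz (y := sSup (S z) • e) (by simp [hue]) (by simp [hy]) ?_ (hmem z hz)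
        rw [norm_smul, norm_smul, he, norm_div, norm_norm, mul_one, div_mul_cancel₀ _ h1.ne']
      have h4 : ‖z • a‖ ≤ 1 := by rwa [hza, div_le_one h0]
      have h5 : z • a + y = (1 - ‖y‖ / sSup (S z)) • (z • a) +
          (‖y‖ / sSup (S z)) • (z • a + (sSup (S z) / ‖y‖) • y) := by
        rw [smul_add (‖y‖ / sSup (S z)), smul_smul _ (sSup (S z) / ‖y‖),
          div_mul_div_cancel₀ hG.ne', div_self h1.ne']
        module
      have h6 : ‖y‖ / sSup (S z) ≤ 1 := by rwa [div_le_one hG]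
      have h7 : 0 ≤ ‖y‖ / sSup (S z) := by positivity
      rw [h5]
      refine (norm_add_le _ _).trans ?_
      rw [norm_smul _ (z • a), norm_smul (‖y‖ / sSup (S z)), Real.norm_of_nonneg h7,
        Real.norm_of_nonneg (by linarith)]
      nlinarith
  refine ⟨fun z => sSup (S z), ?_, ?_, ⟨convex_Icc _ _, ?_⟩, hnn, ?_, hiff⟩
  · have h1 := (hiff 0 (by simpa using h0.le) e hue).1 (by simp [he])
    have h2 : ‖(0 : ℝ) • a + sSup (S 0) • e‖ ≤ 1 := hmem 0 (by simpa using h0.le)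
    rw [zero_smul, zero_add, norm_smul, he, mul_one] at h2
    rw [he] at h1
    exact le_antisymm ((Real.le_norm_self _).trans h2) h1
  · have aux : ∀ z, |z| ≤ h → sSup (S z) ≤ sSup (S (-z)) := fun z hz => by
      have h1 := (hiff (-z) (by rwa [abs_neg]) (-(sSup (S z) • e)) (by simp [hue])).1 (by
        rw [neg_smul, ← neg_add, norm_neg]
        exact hmem z hz)
      rw [norm_neg, norm_smul, he, mul_one] at h1
      exact (Real.le_norm_self _).trans h1
    intro z hz
    refine le_antisymm ?_ (aux z hz)
    simpa using aux (-z) (by rwa [abs_neg])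
  · intro z₁ hz₁ z₂ hz₂ p q hp hq hpq
    have m1 : ‖z₁ • a + sSup (S z₁) • e‖ ≤ 1 := hmem z₁ (abs_le.2 hz₁)
    have m2 : ‖z₂ • a + sSup (S z₂) • e‖ ≤ 1 := hmem z₂ (abs_le.2 hz₂)
    simp only [smul_eq_mul]
    refine le_csSup (hSb _) (?_ : ‖_‖ ≤ 1)
    have : (p * z₁ + q * z₂) • a + (p * sSup (S z₁) + q * sSup (S z₂)) • e =
        p • (z₁ • a + sSup (S z₁) • e) + q • (z₂ • a + sSup (S z₂) • e) := by module
    rw [this]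
    refine (norm_add_le _ _).trans ?_
    rw [norm_smul, norm_smul, Real.norm_of_nonneg hp, Real.norm_of_nonneg hq]
    nlinarith
  · intro z hz
    have h1 : 1 - |z| / h ≤ sSup (S z) := by
      have h2 : 0 ≤ 1 - |z| / h := by rw [sub_nonneg, div_le_one h0]; exact hz.le
      refine le_csSup (hSb z) (?_ : ‖_‖ ≤ 1)
      refine (norm_add_le _ _).trans ?_
      rw [hza, norm_smul, he, Real.norm_of_nonneg h2]
      linarith
    have : |z| / h < 1 := by rwa [div_lt_one h0]
    linarith

end

lemma ConcaveOn.exists_two_sided_expansion {S : Set ℝ} {G : ℝ → ℝ} (hG : ConcaveOn ℝ S G) {x : ℝ}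
    (hx : x ∈ interior S) : ∃ p q : ℝ,
      (∀ τ, x + τ ∈ S → G (x + τ) ≤ G x + min (p * τ) (q * τ)) ∧
      ∀ ε : ℝ, 0 < ε → ∀ᶠ τ in nhds (0 : ℝ), G x + min (p * τ) (q * τ) - ε * |τ| ≤ G (x + τ) := by
  have hF : ConvexOn ℝ S (-G) := hG.neg
  have hd₁ := hF.hasDerivWithinAt_rightDeriv_of_mem_interior hx
  have hd₂ := hF.hasDerivWithinAt_leftDeriv_of_mem_interior hx
  have hle := hF.leftDeriv_le_rightDeriv_of_mem_interior hx
  have hr : ∀ y ∈ S, x < y → _ := fun y hy hxy => hF.rightDeriv_le_slope_of_mem_interior hx hy hxy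
  have hl : ∀ y ∈ S, y < x → _ := fun y hy hxy => hF.slope_le_leftDeriv_of_mem_interior hy hx hxy
  set b := derivWithin (-G) (Set.Ioi x) x
  set a := derivWithin (-G) (Set.Iio x) x
  refine ⟨-b, -a, ?_, ?_⟩
  · intro τ hτ
    rcases lt_trichotomy τ 0 with h | h | h
    · have h1 := hl _ hτ (by linarith)
      rw [slope_def_field, div_le_iff₀ (by linarith)] at h1
      simp only [Pi.neg_apply] at h1
      rw [← sub_le_iff_le_add', le_min_iff]
      constructor <;> nlinarith
    · simp [h]
    · have h1 := hr _ hτ (by linarith)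
      rw [slope_def_field, le_div_iff₀ (by linarith)] at h1
      simp only [Pi.neg_apply] at h1
      rw [← sub_le_iff_le_add', le_min_iff]
      constructor <;> nlinarith
  · intro ε hε
    rw [hasDerivWithinAt_iff_isLittleO] at hd₁ hd₂
    have e1 := eventually_nhdsWithin_iff.1 (hd₁.bound hε)
    have e2 := eventually_nhdsWithin_iff.1 (hd₂.bound hε)
    have ht : Filter.Tendsto (fun τ : ℝ => x + τ) (nhds 0) (nhds x) := by
      have : Continuous fun τ : ℝ => x + τ := by fun_prop
      simpa using this.tendsto 0
    filter_upwards [ht.eventually e1, ht.eventually e2] with τ h1 h2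
    simp only [add_sub_cancel_left, Pi.neg_apply, smul_eq_mul, Real.norm_eq_abs] at h1 h2
    rw [sub_le_iff_le_add, ← le_sub_iff_add_le', min_le_iff]
    rcases lt_trichotomy τ 0 with h | h | h
    · right
      have := (abs_le.1 (h2 (by simpa using h))).2
      linarith
    · left; simp [h]
    · left
      have := (abs_le.1 (h1 (by simpa using h))).2
      linarith

lemma quadratic_of_reflections {h : ℝ} (hh : 1 < h) {G : ℝ → ℝ} (hG0 : G 0 = 1)
    (heven : ∀ z, |z| ≤ h → G (-z) = G z) (hconc : ConcaveOn ℝ (Set.Icc (-h) h) G)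
    (hnn : ∀ z, |z| ≤ h → 0 ≤ G z)
    (hG1 : G 1 < 1)
    (hrefl : ∀ s : ℝ, 0 < s → ∃ δ : ℝ, ∀ z, |z| ≤ h → (z - 1) ^ 2 / s ^ 2 ≤ G z ^ 2 →
      |2 * δ - z| ≤ h ∧
        G (2 * δ - z) ^ 2 - (2 * δ - z - 1) ^ 2 / s ^ 2 = G z ^ 2 - (z - 1) ^ 2 / s ^ 2) :
    ∀ z, |z| ≤ h → G z ^ 2 = 1 - z ^ 2 / h ^ 2 := by
  have hh0 : 0 < h := by linarith
  have hlow : ∀ z, |z| ≤ h → 1 - |z| / h ≤ G z := by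
    have key : ∀ z, 0 ≤ z → z ≤ h → 1 - z / h ≤ G z := by
      intro z hz0 hzh
      have hz1 : z / h ≤ 1 := (div_le_one hh0).2 hzh
      have h1 := hconc.2 (show (0 : ℝ) ∈ Set.Icc (-h) h from ⟨by linarith, hh0.le⟩)
        (show h ∈ Set.Icc (-h) h from ⟨by linarith, le_rfl⟩)
        (show 0 ≤ 1 - z / h by linarith) (show 0 ≤ z / h by positivity) (by ring)
      have h2 : (1 - z / h) • (0 : ℝ) + (z / h) • h = z := by
        simp only [smul_eq_mul]; field_simp; ring
      rw [h2, hG0] at h1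
      have := hnn h (abs_of_pos hh0).le
      simp only [smul_eq_mul] at h1
      nlinarith [mul_nonneg (div_nonneg hz0 hh0.le) this]
    intro z hz
    rcases abs_cases z with ⟨h1, h2⟩ | ⟨h1, h2⟩
    · rw [h1]; exact key z h2 (by linarith)
    · rw [h1, ← heven z hz]; exact key (-z) (by linarith) (by linarith)
  have hcont : ContinuousOn G (Set.Ioo (-h) h) := by
    have := hconc.continuousOn_interior
    rwa [interior_Icc] at this
  choose! δ hδ using hrefl
  -- eventually, everything of absolute value at most `z₁ < h` is in range
  have hrange : ∀ ε : ℝ, 0 < ε → ∀ᶠ s : ℝ in Filter.atTop, 0 < s ∧ (h + 1) ^ 2 / s ^ 2 ≤ ε := by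
    intro ε hε
    have h1 : Filter.Tendsto (fun s : ℝ => (h + 1) ^ 2 / s ^ 2) Filter.atTop (nhds 0) :=
      Filter.Tendsto.div_atTop tendsto_const_nhds (Filter.tendsto_pow_atTop two_ne_zero)
    filter_upwards [h1.eventually (gt_mem_nhds hε), Filter.eventually_gt_atTop 0] with s hs hs0
    exact ⟨hs0, hs.le⟩
  have hsq : ∀ z s : ℝ, |z| ≤ h → (z - 1) ^ 2 / s ^ 2 ≤ (h + 1) ^ 2 / s ^ 2 := by
    intro z s hz
    have := abs_le.1 hz
    gcongr ?_ / _
    nlinarith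
  have hin : ∀ z₁, z₁ < h → ∀ᶠ s : ℝ in Filter.atTop, 0 < s ∧
      ∀ z, |z| ≤ z₁ → (z - 1) ^ 2 / s ^ 2 ≤ G z ^ 2 := by
    intro z₁ hz₁
    have hp : 0 < 1 - z₁ / h := by rw [sub_pos, div_lt_one hh0]; exact hz₁
    filter_upwards [hrange ((1 - z₁ / h) ^ 2) (by positivity)] with s ⟨hs0, hs⟩
    refine ⟨hs0, fun z hz => (hsq z s (by linarith)).trans (hs.trans ?_)⟩
    have h1 := hlow z (by linarith)
    have h2 : 1 - z₁ / h ≤ 1 - |z| / h := by gcongr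
    gcongr
    linarith
  have hδlim : Filter.Tendsto δ Filter.atTop (nhds 0) := by
    rw [Metric.tendsto_nhds]
    intro ε hε
    obtain ⟨z₁, hz₁, hz₁h⟩ := exists_between (max_lt hh0 (sub_lt_self h hε))
    have hz₁0 : 0 < z₁ := lt_of_le_of_lt (le_max_left _ _) hz₁
    have hz₁ε : h - ε < z₁ := lt_of_le_of_lt (le_max_right _ _) hz₁
    filter_upwards [hin z₁ hz₁h] with s ⟨hs0, hs⟩
    have h1 := (hδ s hs0 z₁ (by rw [abs_of_pos hz₁0]; exact hz₁h.le)
      (hs _ (abs_of_pos hz₁0).le)).1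
    have h2 := (hδ s hs0 (-z₁) (by rw [abs_neg, abs_of_pos hz₁0]; exact hz₁h.le)
      (hs _ (by rw [abs_neg, abs_of_pos hz₁0]))).1
    rw [abs_le] at h1 h2
    rw [Real.dist_eq, sub_zero, abs_lt]
    constructor <;> linarith
  have hstep : ∀ s, 0 < s → ∀ z, |z| ≤ h → (z - 1) ^ 2 / s ^ 2 ≤ G z ^ 2 →
      G z ^ 2 - G (z - 2 * δ s) ^ 2 = -4 * (1 - δ s) * (z - δ s) / s ^ 2 := by
    intro s hs z hz hzr
    obtain ⟨h1, h2⟩ := hδ s hs z hz hzr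
    have h3 := heven _ h1
    rw [show -(2 * δ s - z) = z - 2 * δ s by ring] at h3
    rw [h3]
    linear_combination (exp := 1) -h2
  have hδne : ∀ᶠ s in Filter.atTop, 0 < s ∧ δ s ≠ 0 := by
    filter_upwards [hin 1 hh] with s ⟨hs0, hs⟩
    refine ⟨hs0, fun h0 => ?_⟩
    have := hstep s hs0 1 (by simpa using hh.le) (hs 1 (by simp))
    have hp : 0 < 4 / s ^ 2 := by positivity
    simp only [h0, mul_zero, sub_zero, sub_self, mul_one, neg_div] at this
    linarith
  have hmain : ∀ z, 0 ≤ z → z < h → G z ^ 2 = 1 - (1 - G 1 ^ 2) * z ^ 2 := by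
    intro z hz0 hzh
    let k : ℝ → ℝ → ℝ := fun z s => (⌊z / |2 * δ s|⌋₊ : ℝ) * |2 * δ s|
    have hkle : ∀ z s, 0 ≤ z → δ s ≠ 0 → 0 ≤ k z s ∧ k z s ≤ z ∧ z - |2 * δ s| ≤ k z s := by
      intro z s hz hs
      have hp : 0 < |2 * δ s| := by positivity
      have h1 := Nat.floor_le (div_nonneg hz hp.le)
      have h2 := Nat.lt_floor_add_one (z / |2 * δ s|)
      rw [div_lt_iff₀ hp] at h2
      rw [le_div_iff₀ hp] at h1
      refine ⟨by positivity, h1, ?_⟩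
      simp only [k]; linarith
    have hklim : ∀ z, 0 ≤ z → Filter.Tendsto (k z) Filter.atTop (nhds z) := by
      intro z hz
      have h1 : Filter.Tendsto (fun s => z - |2 * δ s|) Filter.atTop (nhds z) := by
        have := ((hδlim.const_mul 2).abs).const_sub z
        simpa using this
      refine tendsto_of_tendsto_of_tendsto_of_le_of_le' h1 tendsto_const_nhds ?_ ?_
      · filter_upwards [hδne] with s hs using (hkle z s hz hs.2).2.2
      · filter_upwards [hδne] with s hs using (hkle z s hz hs.2).2.1
    have hGlim : ∀ z, 0 ≤ z → z < h →
        Filter.Tendsto (fun s => G (k z s) ^ 2) Filter.atTop (nhds (G z ^ 2)) := by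
      intro z hz hzh
      have : ContinuousAt G z := hcont.continuousAt (Ioo_mem_nhds (by linarith) hzh)
      exact (this.tendsto.comp (hklim z hz)).pow 2
    have hid : ∀ z₁, 0 ≤ z₁ → z₁ < h → ∀ᶠ s in Filter.atTop,
        G (k z₁ s) ^ 2 + (1 - δ s) / (δ s * s ^ 2) * k z₁ s ^ 2 = 1 := by
      intro z₁ hz₁ hz₁h
      filter_upwards [hin z₁ hz₁h, hδne] with s ⟨hs0, hs⟩ ⟨_, hs'⟩
      have hind : ∀ m : ℕ, |m * (2 * δ s)| ≤ z₁ →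
          G (m * (2 * δ s)) ^ 2 + (1 - δ s) / (δ s * s ^ 2) * (m * (2 * δ s)) ^ 2 = 1 := by
        intro m
        induction m with
        | zero => intro _; simp [hG0]
        | succ m ih =>
          intro hm
          have hm' : |(m : ℝ) * (2 * δ s)| ≤ z₁ := by
            refine le_trans ?_ hm
            have : |(m : ℝ)| ≤ |((m + 1 : ℕ) : ℝ)| := by
              rw [Nat.abs_cast, Nat.abs_cast]; simp
            rw [abs_mul _ (2 * δ s), abs_mul _ (2 * δ s)]
            exact mul_le_mul_of_nonneg_right this (abs_nonneg (2 * δ s))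
          have h1 := hstep s hs0 _ (hm.trans hz₁h.le) (hs _ hm)
          have h2 := ih hm'
          rw [show ((m + 1 : ℕ) : ℝ) * (2 * δ s) - 2 * δ s = m * (2 * δ s) by push_cast; ring] at h1
          rw [sub_eq_iff_eq_add] at h1
          have h4 : (1 - δ s) / (δ s * s ^ 2) * (((m + 1 : ℕ) : ℝ) * (2 * δ s)) ^ 2 =
              (1 - δ s) / (δ s * s ^ 2) * (m * (2 * δ s)) ^ 2 +
                4 * (1 - δ s) * (((m + 1 : ℕ) : ℝ) * (2 * δ s) - δ s) / s ^ 2 := by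
            push_cast
            field_simp
            ring
          rw [h1, h4]
          linear_combination h2
      obtain ⟨a1, a2, _⟩ := hkle z₁ s hz₁ hs'
      have habs : |(⌊z₁ / |2 * δ s|⌋₊ : ℝ) * (2 * δ s)| = k z₁ s := by
        rw [abs_mul, Nat.abs_cast]
      have h1 := hind ⌊z₁ / |2 * δ s|⌋₊ (by rw [habs]; exact a2)
      have h2 : ∀ x, |x| ≤ h → G |x| = G x := by
        intro x hx
        rcases abs_choice x with e | e
        · rw [e]
        · rw [e, heven x hx]
      rw [← h2 _ (by rw [habs]; linarith), ← sq_abs (_ * _), habs] at h1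
      exact h1
    have hfin : ∀ᶠ s in Filter.atTop, (1 - G (k z s) ^ 2) * k 1 s ^ 2 =
        (1 - G (k 1 s) ^ 2) * k z s ^ 2 := by
      filter_upwards [hid z hz0 hzh, hid 1 zero_le_one hh] with s h1 h2
      linear_combination (-k 1 s ^ 2) * h1 + k z s ^ 2 * h2
    have l1 := ((hGlim z hz0 hzh).const_sub 1).mul ((hklim 1 zero_le_one).pow 2)
    have l2 := ((hGlim 1 zero_le_one hh).const_sub 1).mul ((hklim z hz0).pow 2)
    have := tendsto_nhds_unique_of_eventuallyEq l1 l2 hfin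
    linarith
  have hC : 0 < 1 - G 1 ^ 2 := by
    have := hnn 1 (by simpa using hh.le)
    nlinarith
  have hmain' : ∀ z, |z| < h → G z ^ 2 = 1 - (1 - G 1 ^ 2) * z ^ 2 := by
    intro z hz
    rcases abs_cases z with ⟨h1, h2⟩ | ⟨h1, h2⟩
    · exact hmain z h2 (by linarith)
    · rw [← heven z hz.le, hmain (-z) (by linarith) (by linarith)]; ring
  have hCh : (1 - G 1 ^ 2) * h ^ 2 = 1 := by
    apply le_antisymm
    · have h1 : Filter.Tendsto (fun z => (1 - G 1 ^ 2) * z ^ 2) (nhdsWithin h (Set.Iio h))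
          (nhds ((1 - G 1 ^ 2) * h ^ 2)) := by
        have : Continuous fun z : ℝ => (1 - G 1 ^ 2) * z ^ 2 := by fun_prop
        exact this.continuousWithinAt.tendsto
      refine le_of_tendsto h1 ?_
      filter_upwards [Ioo_mem_nhdsLT hh0] with z hz
      have := hmain z hz.1.le hz.2
      nlinarith [sq_nonneg (G z)]
    · by_contra! hlt
      obtain ⟨s, ⟨hs0, hs⟩, _, hs'⟩ :=
        ((hrange (1 - (1 - G 1 ^ 2) * h ^ 2) (by linarith)).and hδne).exists
      have hall : ∀ z, |z| < h → |2 * δ s - z| ≤ h := by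
        intro z hz
        refine (hδ s hs0 z hz.le ((hsq z s hz.le).trans (hs.trans ?_))).1
        rw [hmain' z hz]
        have : z ^ 2 ≤ h ^ 2 := by
          rw [← sq_abs]; gcongr
        nlinarith
      rcases lt_or_gt_of_ne hs' with hneg | hpos
      · have := hall (max 0 (h + δ s)) (by
          rw [abs_of_nonneg (le_max_left _ _)]; exact max_lt hh0 (by linarith))
        rw [abs_le] at this
        have := le_max_right 0 (h + δ s)
        linarith
      · have := hall (-max 0 (h - δ s)) (by
          rw [abs_neg, abs_of_nonneg (le_max_left _ _)]; exact max_lt hh0 (by linarith))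
        rw [abs_le] at this
        have := le_max_right 0 (h - δ s)
        linarith
  have hGh : G h = 0 := by
    by_contra hne
    have hp : 0 < G h ^ 2 := by positivity
    obtain ⟨s, ⟨hs0, hs⟩, _, hs'⟩ := ((hrange (G h ^ 2) hp).and hδne).exists
    have e1 : |h| ≤ h := (abs_of_pos hh0).le
    have h1 := (hδ s hs0 h e1 ((hsq h s e1).trans hs)).1
    have e2 : |-h| ≤ h := by rw [abs_neg]; exact e1
    have h2 := (hδ s hs0 (-h) e2 ((hsq _ s e2).trans (by rw [heven h e1]; exact hs))).1
    rw [abs_le] at h1 h2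
    exact hs' (by linarith)
  have hCeq : 1 - G 1 ^ 2 = 1 / h ^ 2 := by
    field_simp; exact hCh
  intro z hz
  rcases hz.lt_or_eq with hlt | heq
  · rw [hmain' z hlt, hCeq]; ring
  · have h1 : z ^ 2 = h ^ 2 := by rw [← sq_abs, heq]
    have h2 : G z = G h := by
      rcases abs_choice z with e | e
      · rw [← heq, e]
      · rw [← heq, e, heven z hz]
    rw [h2, hGh, h1, div_self (by positivity)]; norm_num

section ScaledSections

variable {Y : Type*} [NormedAddCommGroup Y] [NormedSpace ℝ Y] [FiniteDimensional ℝ Y]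

lemma ConcaveOn.le_apply_zero_of_even {h : ℝ} {G : ℝ → ℝ}
    (heven : ∀ z, |z| ≤ h → G (-z) = G z) (hconc : ConcaveOn ℝ (Set.Icc (-h) h) G)
    {z : ℝ} (hz : |z| ≤ h) : G z ≤ G 0 := by
  have hz' := abs_le.1 hz
  have h1 := hconc.2 (show z ∈ Set.Icc (-h) h from hz')
    (show -z ∈ Set.Icc (-h) h from ⟨by linarith, by linarith⟩)
    (show (0 : ℝ) ≤ 1 / 2 by norm_num) (show (0 : ℝ) ≤ 1 / 2 by norm_num) (by norm_num)
  simp only [smul_eq_mul, heven z hz] at h1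
  rw [show 1 / 2 * z + 1 / 2 * -z = 0 by ring] at h1
  linarith

lemma apply_one_lt_of_sections_symmetric (h2 : 2 ≤ Module.finrank ℝ Y) {h : ℝ} (hh : 1 < h)
    {G : ℝ → ℝ} (hle : ∀ z, |z| ≤ h → G z ≤ 1)
    (hpos : ∀ z, |z| < h → 0 < G z)
    (hsec : ∀ ℓ : Y →L[ℝ] ℝ, ∃ c : Y, ∀ y, |1 + ℓ y| ≤ h → ‖y‖ ≤ G (1 + ℓ y) →
      |1 + ℓ ((2 : ℝ) • c - y)| ≤ h ∧ ‖(2 : ℝ) • c - y‖ ≤ G (1 + ℓ ((2 : ℝ) • c - y))) :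
    G 1 < 1 := by
  refine lt_of_le_of_ne (hle 1 (by simpa using hh.le)) fun hG1 => ?_
  obtain ⟨x, hx⟩ := (isCompact_closedBall (0 : Y) 1).extremePoints_nonempty ⟨0, by simp⟩
  have hx1 : ‖x‖ ≤ 1 := by simpa using hx.1
  obtain ⟨ℓ₀, hℓ₀, hℓx⟩ : ∃ ℓ₀ : Y →ₗ[ℝ] ℝ, ℓ₀ ≠ 0 ∧ ℓ₀ x = 0 := by
    have hlt : Submodule.span ℝ {x} < ⊤ := by
      rw [lt_top_iff_ne_top]
      intro h
      have h1 := finrank_span_le_card (R := ℝ) (M := Y) ({x} : Set Y)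
      rw [h, finrank_top, Set.toFinset_singleton, Finset.card_singleton] at h1
      omega
    obtain ⟨f, hf, hle⟩ := Submodule.exists_le_ker_of_lt_top _ hlt
    exact ⟨f, hf, hle (Submodule.subset_span (by simp))⟩
  obtain ⟨k, hk⟩ : ∃ k, ℓ₀ k = 1 := by
    obtain ⟨k, hk⟩ : ∃ w, ℓ₀ w ≠ 0 := by
      by_contra! h
      exact hℓ₀ (LinearMap.ext h)
    exact ⟨(ℓ₀ k)⁻¹ • k, by simp [hk]⟩
  have hg : 0 < G (1 - h) := hpos _ (by rw [abs_lt]; constructor <;> linarith)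
  set t : ℝ := h * (‖k‖ + 1) / G (1 - h) with ht
  have hh0 : 0 < h := by linarith
  have ht0 : 0 < t := by positivity
  obtain ⟨c, hc⟩ := hsec (t • LinearMap.toContinuousLinearMap ℓ₀)
  simp only [FunLike.coe_smul, Pi.smul_apply, LinearMap.coe_toContinuousLinearMap', smul_eq_mul,
    map_sub, map_smul] at hc
  have hxc := hc x (by simpa [hℓx] using hh.le) (by simpa [hℓx, hG1] using hx1)
  have hxc' := hc (-x) (by simpa [hℓx] using hh.le) (by simpa [hℓx, hG1] using hx1)
  have b1 := hxc.2.trans (hle _ hxc.1)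
  have b2 := hxc'.2.trans (hle _ hxc'.1)
  have hc0 : c = 0 := by
    have h1 := hx.2 (x₁ := x - (2 : ℝ) • c) (x₂ := x + (2 : ℝ) • c)
      (by rw [mem_closedBall_zero_iff, ← norm_neg, neg_sub]; exact b1)
      (by rw [mem_closedBall_zero_iff, add_comm]; simpa using b2)
      ⟨1 / 2, 1 / 2, by norm_num, by norm_num, by norm_num, by module⟩
    simpa using h1
  have hy := hc (-((h / t) • k)) (by
      have : t * (h / t) = h := by field_simp
      simp only [map_neg, map_smul, hk, smul_eq_mul, mul_one, mul_neg, this]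
      rw [abs_le]; constructor <;> linarith) (by
      have : t * (h / t) = h := by field_simp
      simp only [map_neg, map_smul, hk, smul_eq_mul, mul_one, mul_neg, this]
      rw [norm_neg, norm_smul, Real.norm_of_nonneg (by positivity), ← sub_eq_add_neg]
      rw [div_mul_eq_mul_div, div_le_iff₀ ht0, ht]
      field_simp
      linarith)
  have : t * (h / t) = h := by field_simp
  have h3 := hy.1
  simp only [hc0, map_zero, map_neg, map_smul, hk, smul_eq_mul, mul_one, mul_zero, zero_sub,
    mul_neg, neg_neg, this] at h3
  have := le_abs_self (1 + h)
  linarith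

/-- The centers of the sections `1 + tℓ`, rescaled, converge to a vector dual to `ℓ`. -/
lemma exists_limit_center {h : ℝ} (hh : 1 < h)
    {G : ℝ → ℝ} (hle : ∀ z, |z| ≤ h → G z ≤ 1) (hr : 0 < G 1)
    {p q : ℝ} (hup : ∀ τ, |1 + τ| ≤ h → G (1 + τ) ≤ G 1 + min (p * τ) (q * τ))
    (hdown : ∀ ε : ℝ, 0 < ε → ∀ᶠ τ in nhds (0 : ℝ),
      G 1 + min (p * τ) (q * τ) - ε * |τ| ≤ G (1 + τ)) (ℓ : Y →L[ℝ] ℝ)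
    (hsec : ∀ t : ℝ, ∃ c : Y, ∀ y, |1 + t * ℓ y| ≤ h → ‖y‖ ≤ G (1 + t * ℓ y) →
      |1 + t * ℓ ((2 : ℝ) • c - y)| ≤ h ∧
        ‖(2 : ℝ) • c - y‖ ≤ G (1 + t * ℓ ((2 : ℝ) • c - y))) :
    ∃ η : Y, ∀ x : Y, ‖x‖ = G 1 → ∀ m : Y →L[ℝ] ℝ, (∀ y, m y ≤ ‖y‖) → m x = ‖x‖ →
      2 * m η = (p + q) * ℓ x := by
  set r := G 1
  choose c hc using hsec
  have hσcont : Continuous fun τ : ℝ => min (p * τ) (q * τ) := by fun_prop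
  have hσabs : ∀ τ : ℝ, |min (p * τ) (q * τ)| ≤ (|p| + |q|) * |τ| := by
    intro τ
    rcases min_choice (p * τ) (q * τ) with e | e <;> rw [e, abs_mul]
    · gcongr; linarith [abs_nonneg q]
    · gcongr; linarith [abs_nonneg p]
  have hσmul : ∀ s τ : ℝ, 0 ≤ s → min (p * (s * τ)) (q * (s * τ)) = s * min (p * τ) (q * τ) := by
    intro s τ hs
    rw [mul_min_of_nonneg _ _ hs]; congr 1 <;> ring
  set C := |p| + |q| + 1 with hC
  have hC0 : 0 < C := by positivity
  set L := ‖ℓ‖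
  have hL0 : 0 ≤ L := norm_nonneg _
  -- the rescaled centers are bounded
  have hupC : ∀ τ, |1 + τ| ≤ h → G (1 + τ) ≤ r + C * |τ| := by
    intro τ hτ
    have h1 := hup τ hτ
    have h2 := (abs_le.1 (hσabs τ)).2
    nlinarith [abs_nonneg τ]
  have hdownC : ∀ᶠ τ in nhds (0 : ℝ), r - C * |τ| ≤ G (1 + τ) := by
    filter_upwards [hdown 1 one_pos] with τ hτ
    have h2 := (abs_le.1 (hσabs τ)).1
    nlinarith [abs_nonneg τ]
  obtain ⟨ρ, hρ0, hρ⟩ := Metric.eventually_nhds_iff.1 hdownC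
  have hbdd : ∀ᶠ t in nhdsWithin (0 : ℝ) (Set.Ioi 0), ‖t⁻¹ • c t‖ ≤ C * L * (1 + r) := by
    have e1 : ∀ᶠ t in nhds (0 : ℝ), |t| * (L * r) < min ρ (h - 1) := by
      have : Continuous fun t : ℝ => |t| * (L * r) := by fun_prop
      have h0 := this.tendsto 0
      simp only [abs_zero, zero_mul] at h0
      exact h0.eventually (gt_mem_nhds (lt_min hρ0 (by linarith)))
    have e2 : ∀ᶠ t in nhds (0 : ℝ), C * |t| * (L * r) < r := by
      have : Continuous fun t : ℝ => C * |t| * (L * r) := by fun_prop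
      have h0 := this.tendsto 0
      simp only [abs_zero, zero_mul, mul_zero] at h0
      exact h0.eventually (gt_mem_nhds hr)
    filter_upwards [nhdsWithin_le_nhds e1, nhdsWithin_le_nhds e2, self_mem_nhdsWithin]
      with t h1 h2 ht
    have ht : 0 < t := ht
    rw [abs_of_pos ht] at h1 h2
    rcases eq_or_ne (c t) 0 with h0 | h0
    · rw [h0]; simp; positivity
    have hn : 0 < ‖c t‖ := norm_pos_iff.2 h0
    set lam := r - C * t * (L * r) with hlam
    have hlam0 : 0 < lam := by linarith
    have hlamr : lam ≤ r := by
      have : 0 ≤ C * t * (L * r) := by positivity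
      linarith
    set y : Y := -((lam / ‖c t‖) • c t) with hy
    have hyn : ‖y‖ = lam := by
      rw [hy, norm_neg, norm_smul, Real.norm_of_nonneg (by positivity)]
      field_simp
    have hℓy : |t * ℓ y| ≤ t * (L * r) := by
      rw [abs_mul, abs_of_pos ht]
      gcongr
      have := ℓ.le_opNorm y
      rw [hyn, Real.norm_eq_abs] at this
      exact this.trans (by gcongr)
    have h3 := abs_le.1 hℓy
    have h4 := lt_min_iff.1 h1
    have h5 := hc t y (by rw [abs_le]; constructor <;> linarith) (by
      rw [hyn]
      refine le_trans ?_ (hρ (y := t * ℓ y) (by rw [dist_zero_right, Real.norm_eq_abs]; linarith))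
      have := mul_le_mul_of_nonneg_left hℓy hC0.le
      linarith)
    have h6 := h5.2.trans (hupC _ h5.1)
    have h7 : ‖(2 : ℝ) • c t - y‖ = 2 * ‖c t‖ + lam := by
      have : (2 : ℝ) • c t - y = (2 + lam / ‖c t‖) • c t := by rw [hy]; module
      rw [this, norm_smul, Real.norm_of_nonneg (by positivity)]
      field_simp
    have h8 : |t * ℓ ((2 : ℝ) • c t - y)| ≤ t * L := by
      rw [abs_mul, abs_of_pos ht]
      gcongr
      have := ℓ.le_opNorm ((2 : ℝ) • c t - y)
      refine this.trans ?_
      have h9 := h5.2.trans (hle _ h5.1)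
      exact mul_le_of_le_one_right hL0 h9
    have h9 := mul_le_mul_of_nonneg_left h8 hC0.le
    rw [norm_smul, norm_inv, Real.norm_of_nonneg ht.le, inv_mul_le_iff₀ ht]
    nlinarith
  obtain ⟨u, hu⟩ : ∃ u : ℕ → ℝ, Filter.Tendsto u Filter.atTop (nhdsWithin 0 (Set.Ioi 0)) :=
    Filter.exists_seq_tendsto _
  obtain ⟨N, hN⟩ := Filter.eventually_atTop.1 (hu.eventually hbdd)
  obtain ⟨η, -, φ, hφ, hη⟩ := tendsto_subseq_of_bounded
    (x := fun n => (u (n + N))⁻¹ • c (u (n + N)))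
    (Metric.isBounded_closedBall (x := (0 : Y)) (r := C * L * (1 + r)))
    (fun n => by simpa using hN (n + N) (by omega))
  set w : ℕ → ℝ := fun n => u (φ n + N) with hw
  have hw0 : Filter.Tendsto w Filter.atTop (nhdsWithin 0 (Set.Ioi 0)) :=
    (hu.comp (Filter.tendsto_add_atTop_nat N)).comp hφ.tendsto_atTop
  have hη' : Filter.Tendsto (fun n => (w n)⁻¹ • c (w n)) Filter.atTop (nhds η) := hη
  have hw00 : Filter.Tendsto w Filter.atTop (nhds 0) := hw0.mono_right nhdsWithin_le_nhds
  have hwpos : ∀ᶠ n in Filter.atTop, 0 < w n := hw0.eventually self_mem_nhdsWithin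
  refine ⟨η, ?_⟩
  have half : ∀ x : Y, ‖x‖ = r → ∀ m : Y →L[ℝ] ℝ, (∀ y, m y ≤ ‖y‖) → m x = ‖x‖ →
      (p + q) * ℓ x ≤ 2 * m η := by
    intro x hx m hm hmx
    refine le_of_forall_pos_le_add fun ε hε => ?_
    set σx := min (p * ℓ x) (q * ℓ x) with hσx
    set lam : ℕ → ℝ := fun n => 1 + w n * ((σx - ε) / r) with hlam
    have hlam1 : Filter.Tendsto lam Filter.atTop (nhds 1) := by
      have := (hw00.mul_const ((σx - ε) / r)).const_add 1
      simpa using this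
    have hτ0 : Filter.Tendsto (fun n => w n * (lam n * ℓ x)) Filter.atTop (nhds 0) := by
      have := hw00.mul (hlam1.mul_const (ℓ x))
      simpa using this
    set ε' := ε / (|ℓ x| + 1) with hε'
    have hε'0 : 0 < ε' := by positivity
    have hε'ε : ε' * |ℓ x| < ε := by
      rw [hε', div_mul_eq_mul_div, div_lt_iff₀ (by positivity)]
      nlinarith [abs_nonneg (ℓ x)]
    have hlow : ∀ᶠ n in Filter.atTop, w n * (σx - ε) ≤ G (1 + w n * (lam n * ℓ x)) - r := by
      have h1 : Filter.Tendsto (fun n => min (p * (lam n * ℓ x)) (q * (lam n * ℓ x)) -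
          ε' * |lam n * ℓ x|) Filter.atTop (nhds (σx - ε' * |ℓ x|)) := by
        have hcont : Continuous fun τ : ℝ => min (p * τ) (q * τ) - ε' * |τ| := by fun_prop
        have := (hcont.tendsto (ℓ x)).comp (by simpa using hlam1.mul_const (ℓ x))
        exact this
      filter_upwards [h1.eventually (lt_mem_nhds (show σx - ε < σx - ε' * |ℓ x| by linarith)),
        hτ0.eventually (hdown ε' hε'0), hwpos] with n h2 h3 h4
      rw [hσmul _ _ h4.le, abs_mul, abs_of_pos h4] at h3
      nlinarith
    have hin : ∀ᶠ n in Filter.atTop, |1 + w n * (lam n * ℓ x)| ≤ h := by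
      have h1 : Filter.Tendsto (fun n => |1 + w n * (lam n * ℓ x)|) Filter.atTop (nhds 1) := by
        have := (hτ0.const_add 1).abs
        simpa using this
      filter_upwards [h1.eventually (gt_mem_nhds hh)] with n hn using hn.le
    have hineq : ∀ᶠ n in Filter.atTop, σx - ε - 2 * m ((w n)⁻¹ • c (w n)) ≤
        min (p * (2 * ℓ (c (w n)) - lam n * ℓ x)) (q * (2 * ℓ (c (w n)) - lam n * ℓ x)) := by
      filter_upwards [hlow, hin, hwpos, hlam1.eventually (lt_mem_nhds one_pos)]
        with n h1 h2 h3 h4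
      have hlr : lam n * r = r + w n * (σx - ε) := by
        simp only [hlam]; field_simp
      have h5 := hc (w n) (lam n • x) (by simpa using h2) (by
        rw [norm_smul, hx, Real.norm_of_nonneg h4.le, hlr, map_smul, smul_eq_mul]
        linarith)
      have h6 := h5.2.trans (hup _ h5.1)
      rw [hσmul _ _ h3.le] at h6
      have h7 : m (lam n • x - (2 : ℝ) • c (w n)) ≤ ‖(2 : ℝ) • c (w n) - lam n • x‖ := by
        rw [norm_sub_rev]; exact hm _
      simp only [map_sub, map_smul, smul_eq_mul, hmx, hx] at h6 h7 ⊢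
      have h8 : w n * ((w n)⁻¹ * m (c (w n))) = m (c (w n)) := by field_simp
      refine le_of_mul_le_mul_left ?_ h3
      have h9 := h7.trans h6
      rw [hlr] at h9
      linarith
    have hcw : Filter.Tendsto (fun n => c (w n)) Filter.atTop (nhds 0) := by
      have h1 := hw00.smul hη'
      rw [zero_smul] at h1
      refine h1.congr' ?_
      filter_upwards [hwpos] with n hn
      rw [smul_smul, mul_inv_cancel₀ hn.ne', one_smul]
    have hL : Filter.Tendsto (fun n => σx - ε - 2 * m ((w n)⁻¹ • c (w n))) Filter.atTop
        (nhds (σx - ε - 2 * m η)) :=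
      (((m.continuous.tendsto η).comp hη').const_mul 2).const_sub _
    have hR : Filter.Tendsto (fun n => min (p * (2 * ℓ (c (w n)) - lam n * ℓ x))
        (q * (2 * ℓ (c (w n)) - lam n * ℓ x))) Filter.atTop
        (nhds (min (p * (-ℓ x)) (q * (-ℓ x)))) := by
      refine (hσcont.tendsto (-ℓ x)).comp ?_
      have h1 := ((ℓ.continuous.tendsto 0).comp hcw).const_mul 2
      have := h1.sub (hlam1.mul_const (ℓ x))
      simpa using this
    have hfin := le_of_tendsto_of_tendsto hL hR hineq
    have hsum : σx - min (p * (-ℓ x)) (q * (-ℓ x)) = (p + q) * ℓ x := by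
      rw [hσx, mul_neg, mul_neg, min_neg_neg, sub_neg_eq_add, min_add_max]
      ring
    linarith
  intro x hx m hm hmx
  refine le_antisymm ?_ (half x hx m hm hmx)
  have := half (-x) (by rwa [norm_neg]) (-m)
    (fun y => by simpa using hm (-y)) (by simpa using hmx)
  simp only [map_neg, FunLike.coe_neg, Pi.neg_apply] at this
  linarith

/-- If every functional is represented by a vector through the duality of the norm, then the norm
comes from an inner product. -/
lemma exists_form_of_dual_vectors {r κ : ℝ} (hr : 0 < r) (hκ : κ ≠ 0)
    (hη : ∀ ℓ : Y →L[ℝ] ℝ, ∃ η : Y, ∀ x : Y, ‖x‖ = r → ∀ m : Y →L[ℝ] ℝ, (∀ y, m y ≤ ‖y‖) →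
      m x = ‖x‖ → 2 * m η = κ * ℓ x) :
    ∃ β : Y →ₗ[ℝ] Y →ₗ[ℝ] ℝ, (∀ x y, β x y = β y x) ∧ ∀ x, β x x = ‖x‖ ^ 2 := by
  choose η hη using hη
  let b := Module.finBasis ℝ (Module.Dual ℝ Y)
  let A : Module.Dual ℝ Y →ₗ[ℝ] Y := b.constr ℝ fun i => η (LinearMap.toContinuousLinearMap (b i))
  have hA : ∀ ℓ : Module.Dual ℝ Y, ∀ x : Y, ‖x‖ = r → ∀ m : Y →L[ℝ] ℝ, (∀ y, m y ≤ ‖y‖) →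
      m x = ‖x‖ → 2 * m (A ℓ) = κ * ℓ x := by
    intro ℓ x hx m hm hmx
    have h1 : (2 : ℝ) • ((m : Y →ₗ[ℝ] ℝ) ∘ₗ A) = κ • Module.Dual.eval ℝ Y x := by
      refine b.ext fun i => ?_
      have h2 := hη (LinearMap.toContinuousLinearMap (b i)) x hx m hm hmx
      simp only [LinearMap.smul_apply, LinearMap.comp_apply, smul_eq_mul, Module.Dual.eval_apply, A,
        Module.Basis.constr_basis]
      simpa using h2
    simpa using LinearMap.congr_fun h1 ℓ
  have hsupp : ∀ x : Y, x ≠ 0 → ∃ m : Y →L[ℝ] ℝ, m x = ‖x‖ ∧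
      ∀ ℓ : Module.Dual ℝ Y, 2 * ‖x‖ * m (A ℓ) = κ * r * ℓ x := by
    intro x hx
    have hn : 0 < ‖x‖ := norm_pos_iff.2 hx
    obtain ⟨m, hm1, hmx⟩ := exists_dual_vector ℝ x hn.ne'
    have hmx : m x = ‖x‖ := by simpa using hmx
    refine ⟨m, hmx, fun ℓ => ?_⟩
    have h1 := hA ℓ ((r / ‖x‖) • x)
      (by rw [norm_smul, Real.norm_of_nonneg (by positivity)]; field_simp) m
      (fun y => (le_abs_self _).trans (by simpa [hm1] using m.le_opNorm y))
      (by rw [norm_smul, Real.norm_of_nonneg (by positivity), map_smul, smul_eq_mul, hmx])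
    rw [map_smul, smul_eq_mul] at h1
    field_simp at h1
    linarith
  have hinj : Function.Injective A := by
    rw [injective_iff_map_eq_zero]
    intro ℓ hℓ
    ext x
    rcases eq_or_ne x 0 with rfl | hx
    · simp
    obtain ⟨m, -, hm⟩ := hsupp x hx
    have := hm ℓ
    rw [hℓ, map_zero, mul_zero] at this
    simpa [hκ, hr.ne'] using this.symm
  let e : Module.Dual ℝ Y ≃ₗ[ℝ] Y :=
    LinearMap.linearEquivOfInjective A hinj Subspace.dual_finrank_eq
  have hAe : ∀ y, A (e.symm y) = y := fun y => e.apply_symm_apply y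
  let Q : Y →ₗ[ℝ] Y →ₗ[ℝ] ℝ := e.symm.toLinearMap
  have hQ : ∀ x, κ * r / 2 * Q x x = ‖x‖ ^ 2 := by
    intro x
    rcases eq_or_ne x 0 with rfl | hx
    · simp
    obtain ⟨m, hmx, hm⟩ := hsupp x hx
    have h1 := hm (e.symm x)
    rw [hAe, hmx] at h1
    have h2 : Q x x = e.symm x x := rfl
    rw [h2]
    linarith
  refine ⟨(κ * r / 4) • (Q + Q.flip), fun x y => ?_, fun x => ?_⟩
  · simp [add_comm]
  · rw [← hQ]
    simp only [LinearMap.smul_apply, LinearMap.add_apply, LinearMap.flip_apply, smul_eq_mul]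
    ring

lemma exists_form_and_profile (h2 : 2 ≤ Module.finrank ℝ Y) {h : ℝ} (hh : 1 < h)
    {G : ℝ → ℝ} (hG0 : G 0 = 1)
    (heven : ∀ z, |z| ≤ h → G (-z) = G z) (hconc : ConcaveOn ℝ (Set.Icc (-h) h) G)
    (hnn : ∀ z, |z| ≤ h → 0 ≤ G z) (hpos : ∀ z, |z| < h → 0 < G z)
    (hsec : ∀ ℓ : Y →L[ℝ] ℝ, ∃ c : Y, ∀ y, |1 + ℓ y| ≤ h → ‖y‖ ≤ G (1 + ℓ y) →
      |1 + ℓ ((2 : ℝ) • c - y)| ≤ h ∧ ‖(2 : ℝ) • c - y‖ ≤ G (1 + ℓ ((2 : ℝ) • c - y))) :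
    (∃ β : Y →ₗ[ℝ] Y →ₗ[ℝ] ℝ, (∀ x y, β x y = β y x) ∧ ∀ x, β x x = ‖x‖ ^ 2) ∧
      ∀ z, |z| ≤ h → G z ^ 2 = 1 - z ^ 2 / h ^ 2 := by
  have hle : ∀ z, |z| ≤ h → G z ≤ 1 := fun z hz => by
    rw [← hG0]; exact hconc.le_apply_zero_of_even heven hz
  have hG1 := apply_one_lt_of_sections_symmetric h2 hh hle hpos hsec
  have hr : 0 < G 1 := hpos 1 (by simpa using hh)
  obtain ⟨p, q, hup, hdown⟩ := hconc.exists_two_sided_expansion (x := 1)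
    (by rw [interior_Icc]; constructor <;> linarith)
  have hpq : p + q ≠ 0 := by
    have h1 := hup (-1) ⟨by linarith, by linarith⟩
    rw [add_neg_cancel, hG0] at h1
    have h2 := min_le_left (p * -1) (q * -1)
    have h3 := min_le_right (p * -1) (q * -1)
    intro h4
    linarith
  obtain ⟨β, hsymm, hβ⟩ := exists_form_of_dual_vectors hr hpq fun ℓ =>
    exists_limit_center hh hle hr (fun τ hτ => hup τ (abs_le.1 hτ)) hdown ℓ
      fun t => hsec (t • ℓ)
  refine ⟨⟨β, hsymm, hβ⟩, quadratic_of_reflections hh hG0 heven hconc hnn hG1 ?_⟩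
  have hunit : ∀ w : Y, w ≠ 0 → ‖(‖w‖)⁻¹ • w‖ = 1 := fun w hw => by
    rw [norm_smul, norm_inv, norm_norm, inv_mul_cancel₀ (norm_ne_zero_iff.2 hw)]
  have : Nontrivial Y := Module.nontrivial_of_finrank_pos (R := ℝ) (by omega)
  obtain ⟨e₀, he₀⟩ := exists_ne (0 : Y)
  set e := (‖e₀‖)⁻¹ • e₀
  have he : β e e = 1 := by rw [hβ, hunit e₀ he₀, one_pow]
  obtain ⟨f₀, hf₀, hf₀0⟩ := Submodule.exists_mem_ne_zero_of_ne_bot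
    (LinearMap.ker_ne_bot_of_finrank_lt (f := β e) (by rw [Module.finrank_self]; omega))
  set f := (‖f₀‖)⁻¹ • f₀
  have hf : β f f = 1 := by rw [hβ, hunit f₀ hf₀0, one_pow]
  have hef : β e f = 0 := by
    have : β e f₀ = 0 := hf₀
    simp [f, this]
  have hfe : β f e = 0 := by rw [hsymm, hef]
  have hbessel : ∀ w, β e w ^ 2 + β f w ^ 2 ≤ ‖w‖ ^ 2 := by
    intro w
    have h1 : 0 ≤ β (w - β e w • e - β f w • f) (w - β e w • e - β f w • f) := by
      rw [hβ]; positivity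
    simp only [map_sub, map_smul, LinearMap.sub_apply, LinearMap.smul_apply, smul_eq_mul, he, hf,
      hef, hfe, hsymm w e, hsymm w f] at h1
    rw [← hβ w]
    nlinarith
  intro s hs
  obtain ⟨c, hc⟩ := hsec (s • LinearMap.toContinuousLinearMap (β e))
  simp only [FunLike.coe_smul, Pi.smul_apply, LinearMap.coe_toContinuousLinearMap',
    smul_eq_mul] at hc
  have hhalf : ∀ z, |z| ≤ h → (z - 1) ^ 2 / s ^ 2 ≤ G z ^ 2 →
      |2 * (1 + s * β e c) - z| ≤ h ∧ G z ^ 2 - (z - 1) ^ 2 / s ^ 2 ≤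
        G (2 * (1 + s * β e c) - z) ^ 2 - (2 * (1 + s * β e c) - z - 1) ^ 2 / s ^ 2 := by
    intro z hz hzr
    obtain ⟨γ, hγ, hγc⟩ : ∃ γ : ℝ, γ ^ 2 = G z ^ 2 - (z - 1) ^ 2 / s ^ 2 ∧
        γ ^ 2 ≤ (2 * β f c - γ) ^ 2 := by
      have h0 := Real.sq_sqrt (sub_nonneg.2 hzr)
      rcases le_total 0 (β f c) with h1 | h1
      · refine ⟨-√(G z ^ 2 - (z - 1) ^ 2 / s ^ 2), by rw [neg_sq, h0], ?_⟩
        nlinarith [Real.sqrt_nonneg (G z ^ 2 - (z - 1) ^ 2 / s ^ 2)]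
      · refine ⟨√(G z ^ 2 - (z - 1) ^ 2 / s ^ 2), h0, ?_⟩
        nlinarith [Real.sqrt_nonneg (G z ^ 2 - (z - 1) ^ 2 / s ^ 2)]
    set y : Y := ((z - 1) / s) • e + γ • f with hy
    have hey : β e y = (z - 1) / s := by simp [hy, he, hef]
    have hfy : β f y = γ := by simp [hy, hf, hfe]
    have hz1 : 1 + s * β e y = z := by rw [hey]; field_simp; ring
    have hyn : ‖y‖ ^ 2 = G z ^ 2 := by
      rw [← hβ]
      have hbil : ∀ w, β w y = ((z - 1) / s) * β w e + γ * β w f := fun w => by simp [hy]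
      rw [hbil y, hsymm y e, hsymm y f, hey, hfy]
      field_simp at hγ ⊢
      linarith
    have h1 := hc y (by rwa [hz1]) (by
      rw [hz1]
      exact (pow_le_pow_iff_left₀ (norm_nonneg _) (hnn z hz) two_ne_zero).1 hyn.le)
    have hz2 : 1 + s * β e ((2 : ℝ) • c - y) = 2 * (1 + s * β e c) - z := by
      rw [← hz1]; simp only [map_sub, map_smul, smul_eq_mul]; ring
    rw [hz2] at h1
    refine ⟨h1.1, ?_⟩
    have h3 := hbessel ((2 : ℝ) • c - y)
    have h4 : ‖(2 : ℝ) • c - y‖ ^ 2 ≤ G (2 * (1 + s * β e c) - z) ^ 2 :=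
      pow_le_pow_left₀ (norm_nonneg _) h1.2 2
    have h5 : β e ((2 : ℝ) • c - y) = (2 * (1 + s * β e c) - z - 1) / s := by
      rw [← hz2]; field_simp; ring
    have h6 : β f ((2 : ℝ) • c - y) = 2 * β f c - γ := by simp [hfy]
    rw [h5, h6, div_pow] at h3
    linarith
  refine ⟨1 + s * β e c, fun z hz hzr => ?_⟩
  obtain ⟨h1, h3⟩ := hhalf z hz hzr
  refine ⟨h1, le_antisymm ?_ h3⟩
  have h4 := (hhalf _ h1 (by linarith)).2
  rwa [sub_sub_cancel] at h4

end ScaledSections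

section

lemma exists_form_of_norm {V : Type*} [NormedAddCommGroup V] [NormedSpace ℝ V]
    [FiniteDimensional ℝ V] (h3 : 3 ≤ Module.finrank ℝ V) {a : V} (ha0 : a ≠ 0) (ha1 : ‖a‖ < 1)
    (hsec : ∀ f : V →ₗ[ℝ] ℝ, ∃ c, f c = f a ∧
      ∀ x, ‖x‖ ≤ 1 → f x = f a → ‖(2 : ℝ) • c - x‖ ≤ 1) :
    ∃ β : V →ₗ[ℝ] V →ₗ[ℝ] ℝ, (∀ x y, β x y = β y x) ∧ ∀ x, β x x = ‖x‖ ^ 2 := by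
  have hna : 0 < ‖a‖ := norm_pos_iff.2 ha0
  obtain ⟨h, hdef⟩ : ∃ h, h = ‖a‖⁻¹ := ⟨_, rfl⟩
  have hh : 1 < h := by rw [hdef]; exact (one_lt_inv₀ hna).2 ha1
  have h0 : 0 < h := by linarith
  have ha : h * ‖a‖ = 1 := by rw [hdef, inv_mul_cancel₀ hna.ne']
  obtain ⟨g, hg1, hga⟩ := exists_dual_vector ℝ a hna.ne'
  obtain ⟨u, hudef⟩ : ∃ u : V →ₗ[ℝ] ℝ, u = h • (g : V →ₗ[ℝ] ℝ) := ⟨_, rfl⟩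
  have hua : u a = 1 := by
    rw [hudef]
    simpa [hga] using ha
  have hu : ∀ x, |u x| ≤ h * ‖x‖ := fun x => by
    have h1 := g.le_opNorm x
    rw [hg1, one_mul, Real.norm_eq_abs] at h1
    have h2 : u x = h * g x := by rw [hudef]; simp
    rw [h2, abs_mul, abs_of_pos h0]
    exact mul_le_mul_of_nonneg_left h1 h0.le
  obtain ⟨G, hG0, heven, hconc, hnn, hpos, hiff⟩ := exists_profile h3 hh ha hu hua hsec
  have h2 : 2 ≤ Module.finrank ℝ (LinearMap.ker u) := by
    have h4 := LinearMap.finrank_range_add_finrank_ker u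
    have h5 := Submodule.finrank_le (LinearMap.range u)
    rw [Module.finrank_self] at h5
    omega
  let π : V →ₗ[ℝ] LinearMap.ker u :=
    (LinearMap.id - u.smulRight a).codRestrict (LinearMap.ker u) fun x => by simp [hua]
  have hπ : ∀ x, (π x : V) = x - u x • a := fun x => rfl
  have hdec : ∀ x, u x • a + (π x : V) = x := fun x => by rw [hπ]; module
  have hπker : ∀ y : LinearMap.ker u, π y = y := fun y => by
    ext
    rw [hπ, LinearMap.mem_ker.1 y.2]
    simp
  have hπa : π a = 0 := by
    ext
    rw [hπ, hua]
    simp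
  obtain ⟨⟨β, hβ1, hβ2⟩, hGsq⟩ := exists_form_and_profile h2 hh hG0 heven hconc hnn hpos (by
    intro ℓ
    obtain ⟨c, hfc, hc⟩ := hsec (u - (ℓ : LinearMap.ker u →ₗ[ℝ] ℝ) ∘ₗ π)
    simp only [LinearMap.sub_apply, LinearMap.comp_apply, ContinuousLinearMap.coe_coe, hua, hπa,
      map_zero, sub_zero] at hfc hc
    refine ⟨π c, fun y hy1 hy2 => ?_⟩
    have hy : u (y : V) = 0 := LinearMap.mem_ker.1 y.2
    have h1 := hc ((1 + ℓ y) • a + y) ((hiff _ hy1 _ hy).2 hy2) (by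
      simp [hua, hπa, hy, hπker])
    have h3 : u ((2 : ℝ) • c - ((1 + ℓ y) • a + y)) = 1 + ℓ ((2 : ℝ) • π c - y) := by
      simp only [map_sub, map_smul, map_add, smul_eq_mul, hua, hy]
      linear_combination 2 * hfc
    have h4 : (π ((2 : ℝ) • c - ((1 + ℓ y) • a + y)) : V) =
        ((2 : ℝ) • π c - y : LinearMap.ker u) := by
      simp only [map_sub, map_smul, map_add, hπa, hπker, smul_zero, zero_add]
    have h5 : |1 + ℓ ((2 : ℝ) • π c - y)| ≤ h := by
      rw [← h3]
      exact (hu _).trans (by nlinarith)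
    refine ⟨h5, (hiff _ h5 _ (LinearMap.mem_ker.1 ((2 : ℝ) • π c - y).2)).1 ?_⟩
    rw [← h3, ← h4, hdec]
    exact h1)
  obtain ⟨γ, hγ⟩ : ∃ γ : V →ₗ[ℝ] V →ₗ[ℝ] ℝ, ∀ x y, γ x y = β (π x) (π y) + u x * u y / h ^ 2 :=
    ⟨β.compl₁₂ π π + (h ^ 2)⁻¹ • (LinearMap.mul ℝ ℝ).compl₁₂ u u, fun x y => by
      simp only [LinearMap.add_apply, LinearMap.smul_apply, LinearMap.compl₁₂_apply,
        LinearMap.mul_apply', smul_eq_mul]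
      ring⟩
  have hball : ∀ x, ‖x‖ ≤ 1 ↔ γ x x ≤ 1 := by
    intro x
    rw [hγ, hβ2]
    have key : |u x| ≤ h → (‖x‖ ≤ 1 ↔ ‖π x‖ ^ 2 + u x * u x / h ^ 2 ≤ 1) := by
      intro hux
      have h1 := hiff _ hux _ (LinearMap.mem_ker.1 (π x).2)
      rw [hdec] at h1
      rw [h1]
      have h4 := hGsq _ hux
      have h5 := hnn _ hux
      have h6 : ‖π x‖ ^ 2 + u x * u x / h ^ 2 ≤ 1 ↔ ‖π x‖ ^ 2 ≤ G (u x) ^ 2 := by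
        rw [h4, le_sub_iff_add_le, sq (u x)]
      rw [h6]
      exact (sq_le_sq₀ (norm_nonneg _) h5).symm
    constructor
    · intro hx
      exact (key ((hu x).trans (by nlinarith))).1 hx
    · intro hx
      refine (key (abs_le_of_sq_le_sq ?_ h0.le)).2 hx
      have h1 : u x * u x / h ^ 2 ≤ 1 := by nlinarith [sq_nonneg ‖π x‖]
      rw [div_le_one (by positivity)] at h1
      linarith
  have hsm : ∀ (t : ℝ) x, γ (t • x) (t • x) = t ^ 2 * γ x x := fun t x => by
    simp only [map_smul, LinearMap.smul_apply, smul_eq_mul]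
    ring
  have hnonneg : ∀ x, 0 ≤ γ x x := fun x => by
    rw [hγ, hβ2]
    have := mul_self_nonneg (u x)
    positivity
  refine ⟨γ, fun x y => by rw [hγ, hγ, hβ1, mul_comm (u x)], fun x => ?_⟩
  rcases eq_or_ne x 0 with rfl | hx
  · simp
  have hx0 : 0 < ‖x‖ := norm_pos_iff.2 hx
  have hscale : ∀ t : ℝ, 0 < t → (‖x‖ ≤ t ↔ γ x x ≤ t ^ 2) := fun t ht => by
    have := hball (t⁻¹ • x)
    rwa [norm_smul, norm_inv, Real.norm_of_nonneg ht.le, hsm, inv_pow, inv_mul_le_iff₀ ht,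
      inv_mul_le_iff₀ (by positivity), mul_one, mul_one] at this
  refine le_antisymm ((hscale _ hx0).1 le_rfl) ?_
  by_contra! hlt
  obtain ⟨r, hr1, hr2⟩ := exists_between hlt
  have hr0 : 0 < r := (hnonneg x).trans_lt hr1
  have h5 := (hscale (Real.sqrt r) (Real.sqrt_pos.2 hr0)).2 (by
    rw [Real.sq_sqrt hr0.le]
    exact hr1.le)
  have h6 := pow_le_pow_left₀ hx0.le h5 2
  rw [Real.sq_sqrt hr0.le] at h6
  linarith

lemma exists_form_of_seminorm {V : Type*} [AddCommGroup V] [Module ℝ V]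
    [FiniteDimensional ℝ V] (h3 : 3 ≤ Module.finrank ℝ V) (p : Seminorm ℝ V)
    (hp : ∀ x, p x = 0 → x = 0) {a : V} (ha0 : a ≠ 0) (ha1 : p a < 1)
    (hsec : ∀ f : V →ₗ[ℝ] ℝ, ∃ c, f c = f a ∧
      ∀ x, p x ≤ 1 → f x = f a → p ((2 : ℝ) • c - x) ≤ 1) :
    ∃ β : V →ₗ[ℝ] V →ₗ[ℝ] ℝ, (∀ x y, β x y = β y x) ∧ ∀ x, β x x = p x ^ 2 := by
  let _ : NormedAddCommGroup V := AddGroupNorm.toNormedAddCommGroup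
    { p.toAddGroupSeminorm with eq_zero_of_map_eq_zero' := hp }
  let _ : NormedSpace ℝ V := ⟨fun t x => (map_smul_eq_mul p t x).le⟩
  exact exists_form_of_norm h3 ha0 ha1 hsec

/-- A positive definite form is the squared Euclidean norm in suitable coordinates. -/
lemma exists_linearEquiv_norm_sq {V : Type*} [AddCommGroup V] [Module ℝ V]
    [FiniteDimensional ℝ V] {m : ℕ} (hm : Module.finrank ℝ V = m) {β : V →ₗ[ℝ] V →ₗ[ℝ] ℝ}
    (hsymm : ∀ x y, β x y = β y x) (hpos : ∀ x, x ≠ 0 → 0 < β x x) :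
    ∃ L : V ≃ₗ[ℝ] EuclideanSpace ℝ (Fin m), ∀ x, ‖L x‖ ^ 2 = β x x := by
  let core : InnerProductSpace.Core ℝ V :=
    { inner := fun x y => β x y
      conj_inner_symm := fun x y => hsymm y x
      re_inner_nonneg := fun x => by
        rcases eq_or_ne x 0 with rfl | hx
        · simp
        · exact (hpos x hx).le
      add_left := fun x y z => by simp
      smul_left := fun x y r => by simp
      definite := fun x hx => by
        by_contra hne
        exact (hpos x hne).ne' hx }
  let _ : NormedAddCommGroup V := core.toNormedAddCommGroup
  let _ : InnerProductSpace ℝ V := InnerProductSpace.ofCore core.toCore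
  let b := (stdOrthonormalBasis ℝ V).reindex (finCongr hm)
  refine ⟨b.repr.toLinearEquiv, fun x => ?_⟩
  have h1 : ‖b.repr.toLinearEquiv x‖ = ‖x‖ := b.repr.norm_map x
  rw [h1, ← real_inner_self_eq_norm_sq]
  rfl

lemma exists_form_of_false_center {E : Type*} [NormedAddCommGroup E] [NormedSpace ℝ E]
    [FiniteDimensional ℝ E] (h3 : 3 ≤ Module.finrank ℝ E) {B : Set E} (hBc : IsCompact B)
    (hBconv : Convex ℝ B) (hB0 : 0 ∈ interior B)
    (hsec : ∀ f : E →ₗ[ℝ] ℝ, f ≠ 0 → ∃ c, f c = 0 ∧ ∀ y ∈ B, f y = 0 → (2 : ℝ) • c - y ∈ B)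
    {a : E} (ha : a ≠ 0) (hsymm : ∀ y ∈ B, (2 : ℝ) • a - y ∈ B) :
    ∃ β : E →ₗ[ℝ] E →ₗ[ℝ] ℝ, (∀ x y, β x y = β y x) ∧ (∀ x, x ≠ 0 → 0 < β x x) ∧
      ∀ y, y ∈ B ↔ β (y - a) (y - a) ≤ 1 := by
  obtain ⟨r, hr, hrB⟩ := Metric.mem_nhds_iff.1 (mem_interior_iff_mem_nhds.1 hB0)
  obtain ⟨K, hK⟩ : ∃ K : Set E, K = (fun x => x + a) ⁻¹' B := ⟨_, rfl⟩
  have hmem : ∀ x, x ∈ K ↔ x + a ∈ B := fun x => by rw [hK]; rfl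
  have hKconv : Convex ℝ K := by
    rw [hK]
    exact hBconv.translate_preimage_left a
  have hKclosed : IsClosed K := by
    rw [hK]
    exact hBc.isClosed.preimage (by fun_prop)
  have hKneg : ∀ x ∈ K, -x ∈ K := fun x hx => by
    rw [hmem] at hx ⊢
    convert hsymm _ hx using 1
    module
  have hball : ball 0 r ⊆ K := fun w hw => by
    rw [hmem]
    have h1 := hsymm _ (hrB (by simpa using hw : -w ∈ ball 0 r))
    convert hBconv (hrB hw) h1 (by norm_num : (0 : ℝ) ≤ 1 / 2) (by norm_num : (0 : ℝ) ≤ 1 / 2)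
      (by norm_num) using 1
    module
  have hKn : K ∈ nhds 0 := Filter.mem_of_superset (ball_mem_nhds 0 hr) hball
  have hKb : Bornology.IsBounded K := by
    obtain ⟨R, hR⟩ := hBc.isBounded.exists_norm_le
    refine (isBounded_closedBall (x := (0 : E)) (r := R + ‖a‖)).subset fun x hx => ?_
    rw [mem_closedBall_zero_iff]
    have h1 := hR _ ((hmem x).1 hx)
    have h2 := norm_sub_le (x + a) a
    rw [add_sub_cancel_right] at h2
    linarith
  have hnega : -a ∈ interior K := by
    rw [mem_interior]
    refine ⟨ball (-a) r, fun x hx => ?_, isOpen_ball, mem_ball_self hr⟩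
    rw [hmem]
    refine hrB ?_
    rw [mem_ball, dist_eq_norm, sub_neg_eq_add] at hx
    simpa using hx
  have habs := absorbent_nhds_zero (𝕜 := ℝ) hKn
  have hle : ∀ x, gauge K x ≤ 1 ↔ x ∈ K := fun x => by
    rw [gauge_le_one_iff_mem_closure hKconv hKn, hKclosed.closure_eq]
  have hpos : ∀ x, x ≠ 0 → 0 < gauge K x := fun x hx =>
    (gauge_pos habs ((NormedSpace.isVonNBounded_iff ℝ).2 hKb)).2 hx
  obtain ⟨β, hβ1, hβ2⟩ := exists_form_of_seminorm h3
    (gaugeSeminorm ((balanced_iff_neg_mem hKconv).2 hKneg) hKconv habs) (fun x hx => by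
      by_contra hne
      exact (hpos x hne).ne' hx) (neg_ne_zero.2 ha)
    ((gauge_lt_one_iff_mem_interior hKconv hKn).2 hnega) (fun f => by
      rcases eq_or_ne f 0 with rfl | hf
      · refine ⟨0, rfl, fun x hx _ => ?_⟩
        have := (hle _).2 (hKneg x ((hle x).1 hx))
        show gauge K ((2 : ℝ) • 0 - x) ≤ 1
        rwa [smul_zero, zero_sub]
      obtain ⟨c, hfc, hc⟩ := hsec f hf
      refine ⟨c - a, by simp [hfc], fun x hx hfx => ?_⟩
      refine (hle _).2 ((hmem _).2 ?_)
      convert hc (x + a) ((hmem _).1 ((hle x).1 hx)) (by simp [hfx]) using 1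
      module)
  have hβg : ∀ x, β x x = gauge K x ^ 2 := hβ2
  refine ⟨β, hβ1, fun x hx => ?_, fun y => ?_⟩
  · rw [hβg]
    exact pow_pos (hpos x hx) 2
  · rw [hβg, sq_le_one_iff₀ (gauge_nonneg _), hle, hmem, sub_add_cancel]

end

/-- Larman's False Center theorem: if every hyperplane section through the
origin of a convex body `B ⊆ ℝ^{n+1}` is centrally symmetric, then either `B` is an
ellipsoid or `B` is symmetric with respect to the origin. -/
theorem false_center_theorem
    (n : ℕ) (hn : 2 ≤ n)
    (B : Set (EuclideanSpace ℝ (Fin (n + 1))))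
    (hBcompact : IsCompact B) (hBconv : Convex ℝ B)
    (hB0 : (0 : EuclideanSpace ℝ (Fin (n + 1))) ∈ interior B)
    (hsec : ∀ H : Submodule ℝ (EuclideanSpace ℝ (Fin (n + 1))), Module.finrank ℝ H = n →
      ∃ c : EuclideanSpace ℝ (Fin (n + 1)), c ∈ H ∧
        B ∩ (H : Set (EuclideanSpace ℝ (Fin (n + 1)))) =
          (fun x => (2 : ℝ) • c - x) '' (B ∩ (H : Set (EuclideanSpace ℝ (Fin (n + 1)))))) :
    IsEllipsoid B ∨ B = -B := by
  have hrank : Module.finrank ℝ (EuclideanSpace ℝ (Fin (n + 1))) = n + 1 :=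
    finrank_euclideanSpace_fin
  have h3 : 3 ≤ Module.finrank ℝ (EuclideanSpace ℝ (Fin (n + 1))) := by omega
  have hsec' : ∀ f : EuclideanSpace ℝ (Fin (n + 1)) →ₗ[ℝ] ℝ, f ≠ 0 →
      ∃ c, f c = 0 ∧ ∀ y ∈ B, f y = 0 → (2 : ℝ) • c - y ∈ B := by
    intro f hf
    have hker : Module.finrank ℝ (LinearMap.ker f) = n := by
      have h4 := LinearMap.finrank_range_add_finrank_ker f
      rw [LinearMap.range_eq_top.2 (LinearMap.surjective hf), finrank_top,
        Module.finrank_self] at h4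
      omega
    obtain ⟨c, hc, hBc⟩ := hsec _ hker
    refine ⟨c, hc, fun y hy hfy => ?_⟩
    obtain ⟨x, hx, hxy⟩ := hBc.subset ⟨hy, LinearMap.mem_ker.2 hfy⟩
    have : (2 : ℝ) • c - y = x := by
      rw [← hxy]
      module
    rw [this]
    exact hx.1
  rcases symmetric_or_exists_center h3 hBcompact hBconv hB0 hsec' with hs | ⟨a, ha, hs⟩
  · right
    ext y
    exact ⟨fun hy => hs y hy, fun hy => by simpa using hs _ hy⟩
  · left
    obtain ⟨β, hβ1, hβ2, hβ3⟩ :=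
      exists_form_of_false_center h3 hBcompact hBconv hB0 hsec' ha hs
    obtain ⟨L, hL⟩ := exists_linearEquiv_norm_sq hrank hβ1 hβ2
    refine ⟨L.symm.toAffineEquiv.trans (AffineEquiv.constVAdd ℝ _ a), ?_⟩
    ext y
    rw [hβ3, ← hL, sq_le_one_iff₀ (norm_nonneg _)]
    constructor
    · intro hy
      exact ⟨L (y - a), by simpa using hy, by simp⟩
    · rintro ⟨x, hx, rfl⟩
      simpa using hx
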